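/- arXiv:1506.06872 — 4 statements merged into one kernel-verified Lean document; each statement's English description precedes it below -/
import Mathlib

section
/- If F is a closed subset of a metric space such that the second derived set F'' is nonempty, then F contains a closed subset A whose second derived set A'' consists of exactly one point. -/
open Set Filter

theorem aux_union {X : Type*} [MetricSpace X] (p : X) (r : ℝ) (B : ℕ → Set X)
    (hB : ∀ n, ∀ y ∈ B n, dist y p < r / ((n : ℝ) + 1)) (z : X) (hz : z ≠ p)
    (h : z ∈ derivedSet (⋃ n, B n)) : ∃ n, z ∈ derivedSet (B n) := by
  by_contra hcon
  push Not at hcon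
  have hd : 0 < dist z p := dist_pos.2 hz
  have ht : Tendsto (fun n : ℕ => r / ((n : ℝ) + 1)) atTop (nhds 0) :=
    by simpa [div_eq_mul_inv] using (tendsto_one_div_add_atTop_nhds_zero_nat (𝕜 := ℝ)).const_mul r
  obtain ⟨N, hN⟩ := eventually_atTop.1 (ht.eventually_lt_const (half_pos hd))
  rw [mem_derivedSet, accPt_iff_frequently] at h
  have h1 : ∀ n, ∀ᶠ y in nhds z, ¬ (y ≠ z ∧ y ∈ B n) := by
    intro n
    have := hcon n
    rwa [mem_derivedSet, accPt_iff_frequently, not_frequently] at this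
  have h2 : ∀ᶠ y in nhds z, ∀ n ∈ Finset.range N, ¬ (y ≠ z ∧ y ∈ B n) :=
    (Filter.eventually_all_finset _).2 fun n _ => h1 n
  have h3 : ∀ᶠ y in nhds z, dist y z < dist z p / 2 :=
    Metric.ball_mem_nhds z (half_pos hd)
  obtain ⟨y, ⟨hyz, hy⟩, h2, h3⟩ := (h.and_eventually (h2.and h3)).exists
  obtain ⟨n, hn⟩ := mem_iUnion.1 hy
  by_cases hnN : n < N
  · exact h2 n (Finset.mem_range.2 hnN) ⟨hyz, hn⟩
  · have a := hN n (not_lt.1 hnN)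
    have b := hB n y hn
    have c := dist_triangle z y p
    rw [dist_comm z y] at c
    linarith

theorem aux_single {X : Type*} [MetricSpace X] (a : X) : derivedSet ({a} : Set X) = ∅ := by
  ext z
  simp only [mem_derivedSet, accPt_iff_nhds, mem_empty_iff_false, iff_false]
  intro h
  by_cases hz : z = a
  · obtain ⟨y, ⟨_, hy⟩, hne⟩ := h univ univ_mem
    exact hne (by rw [hz]; exact hy)
  · obtain ⟨y, ⟨h1, hy⟩, hne⟩ := h {a}ᶜ (isOpen_compl_singleton.mem_nhds hz)
    exact h1 hy

theorem aux_seq {X : Type*} [MetricSpace X] (p : X) (S : Set X) (h : p ∈ derivedSet S)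
    (r : ℝ) (hr : 0 < r) : ∃ y : ℕ → X, (∀ n, y n ∈ S) ∧
      (∀ n, dist (y n) p < r / ((n : ℝ) + 1)) ∧ derivedSet (range y) = {p} := by
  rw [mem_derivedSet, accPt_iff_nhds] at h
  have h' : ∀ n : ℕ, ∃ y, y ∈ S ∧ dist y p < r / ((n : ℝ) + 1) ∧ y ≠ p := by
    intro n
    obtain ⟨y, ⟨h1, h2⟩, h3⟩ := h _ (Metric.ball_mem_nhds p (ε := r / ((n : ℝ) + 1)) (by positivity))
    exact ⟨y, h2, h1, h3⟩
  choose y hyS hyd hyp using h'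
  refine ⟨y, hyS, hyd, ?_⟩
  apply Subset.antisymm
  · intro z hz
    by_contra hne
    rw [← iUnion_singleton_eq_range] at hz
    obtain ⟨n, hn⟩ := aux_union p r (fun n => {y n})
      (by intro n w hw; rw [mem_singleton_iff.1 hw]; exact hyd n) z hne hz
    simp only [aux_single] at hn
    exact hn
  · rintro _ rfl
    rw [mem_derivedSet, accPt_iff_nhds]
    intro U hU
    obtain ⟨e, he, hU⟩ := Metric.mem_nhds_iff.1 hU
    have ht : Tendsto (fun n : ℕ => r / ((n : ℝ) + 1)) atTop (nhds 0) :=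
      by simpa [div_eq_mul_inv] using (tendsto_one_div_add_atTop_nhds_zero_nat (𝕜 := ℝ)).const_mul r
    obtain ⟨n, hn⟩ := (ht.eventually_lt_const he).exists
    exact ⟨y n, ⟨hU ((hyd n).trans hn), mem_range_self n⟩, hyp n⟩

theorem stmt6 {X : Type*} [MetricSpace X] (F : Set X) (hF : IsClosed F)
    (hne : (derivedSet (derivedSet F)).Nonempty) :
    ∃ A : Set X, A ⊆ F ∧ IsClosed A ∧
      ∃ p : X, derivedSet (derivedSet A) = {p} := by
  obtain ⟨p, hp⟩ := hne
  obtain ⟨x, hxS, hxd, hx⟩ := aux_seq p _ hp 1 one_pos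
  have h1 : ∀ n : ℕ, ∃ B : Set X, B ⊆ F ∧ (∀ y ∈ B, dist y p < 2 / ((n : ℝ) + 1)) ∧
      derivedSet B = {x n} := by
    intro n
    have hpos : (0 : ℝ) < 1 / ((n : ℝ) + 1) := by positivity
    obtain ⟨y, hyS, hyd, hy⟩ := aux_seq (x n) F (hxS n) (1 / ((n : ℝ) + 1)) hpos
    refine ⟨range y, range_subset_iff.2 hyS, ?_, hy⟩
    rintro _ ⟨m, rfl⟩
    have a := hyd m
    have b : 1 / ((n : ℝ) + 1) / ((m : ℝ) + 1) ≤ 1 / ((n : ℝ) + 1) :=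
      div_le_self hpos.le (by linarith [(Nat.cast_nonneg m : (0 : ℝ) ≤ m)])
    have c := dist_triangle (y m) (x n) p
    have d := hxd n
    have e : 2 / ((n : ℝ) + 1) = 1 / ((n : ℝ) + 1) + 1 / ((n : ℝ) + 1) := by ring
    linarith
  choose B hBF hBd hB using h1
  refine ⟨closure (⋃ n, B n), closure_minimal (iUnion_subset hBF) hF, isClosed_closure, p, ?_⟩
  rw [derivedSet_closure]
  have hsub : range x ⊆ derivedSet (⋃ n, B n) := by
    rintro _ ⟨n, rfl⟩
    apply derivedSet_mono _ _ (subset_iUnion B n)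
    rw [hB n]; rfl
  have hsup : derivedSet (⋃ n, B n) ⊆ range x ∪ {p} := by
    intro z hz
    by_cases hzp : z = p
    · exact Or.inr hzp
    · obtain ⟨n, hn⟩ := aux_union p 2 B hBd z hzp hz
      rw [hB n] at hn
      exact Or.inl ⟨n, hn.symm⟩
  apply Subset.antisymm
  · have := derivedSet_mono _ _ hsup
    rwa [derivedSet_union, hx, aux_single, union_empty] at this
  · rw [← hx]
    exact derivedSet_mono _ _ hsub
end

section
/- Let X be a dendrite and C₁, C₂ two disjoint connected subsets of X. Then the intersection of their closures, cl(C₁) ∩ cl(C₂), contains at most one point. -/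
open Set Metric Filter

/-- A dendrite: a compact, connected, locally connected metric(izable) space
containing no subspace homeomorphic to the circle. -/
def IsDendrite (X : Type*) [TopologicalSpace X] : Prop :=
  CompactSpace X ∧ ConnectedSpace X ∧ LocallyConnectedSpace X ∧
    ∀ s : Set X, ¬ Nonempty (s ≃ₜ (Metric.sphere (0 : ℂ) 1 : Set ℂ))

/-- `A` is an arc from `x` to `y`: the image of an injective continuous map of `[0,1]`. -/
def IsArc {X : Type*} [TopologicalSpace X] (A : Set X) (x y : X) : Prop :=
  ∃ γ : unitInterval → X, Continuous γ ∧ Function.Injective γ ∧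
    γ 0 = x ∧ γ 1 = y ∧ A = Set.range γ


theorem arc_monotone {X : Type*} [MetricSpace X] (f : unitInterval → X) (hf : Continuous f) :
    ∃ g : unitInterval → X, Continuous g ∧ g 0 = f 0 ∧ g 1 = f 1 ∧ range g ⊆ range f ∧
      ∀ s u t, s ≤ u → u ≤ t → g s = g t → g u = g s := by
  let S : Set (Set unitInterval) := {K | IsClosed K ∧ 0 ∈ K ∧ 1 ∈ K ∧
    ∀ u, ∃ s ∈ K, ∃ t ∈ K, s ≤ u ∧ u ≤ t ∧ f s = f t ∧ ∀ k ∈ K, s < k → k < t → False}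
  have hU : (univ : Set unitInterval) ∈ S := by
    refine ⟨isClosed_univ, mem_univ _, mem_univ _, fun u => ⟨u, mem_univ _, u, mem_univ _, le_rfl, le_rfl, rfl, ?_⟩⟩
    intro k _ h1 h2
    exact lt_asymm h1 h2
  obtain ⟨K, -, hK⟩ := zorn_superset_nonempty S (by
    intro c hc hch hne
    have hcl : IsClosed (⋂₀ c) := isClosed_sInter fun K hK => (hc hK).1
    have h0 : (0 : unitInterval) ∈ ⋂₀ c := fun K hK => (hc hK).2.1
    have h1 : (1 : unitInterval) ∈ ⋂₀ c := fun K hK => (hc hK).2.2.1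
    refine ⟨⋂₀ c, ⟨hcl, h0, h1, fun u => ?_⟩, fun K hK => sInter_subset_of_mem hK⟩
    obtain ⟨s, ⟨hs, hsu⟩, hsm⟩ := (hcl.inter (isClosed_Iic (a := u))).isCompact.exists_isGreatest
      ⟨0, h0, unitInterval.nonneg'⟩
    obtain ⟨t, ⟨ht, htu⟩, htm⟩ := (hcl.inter (isClosed_Ici (a := u))).isCompact.exists_isLeast
      ⟨1, h1, unitInterval.le_one'⟩
    refine ⟨s, hs, t, ht, hsu, htu, ?_, ?_⟩
    · let L : c → Set (unitInterval × unitInterval) := fun K =>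
        {p | p.1 ∈ K.1 ∧ p.2 ∈ K.1 ∧ s ≤ p.1 ∧ p.1 ≤ u ∧ u ≤ p.2 ∧ p.2 ≤ t ∧ f p.1 = f p.2}
      have hLcl : ∀ K, IsClosed (L K) := by
        intro K
        have hKc := (hc K.2).1
        refine (hKc.preimage continuous_fst).inter <| (hKc.preimage continuous_snd).inter <|
          (isClosed_le continuous_const continuous_fst).inter <|
          (isClosed_le continuous_fst continuous_const).inter <|
          (isClosed_le continuous_const continuous_snd).inter <|
          (isClosed_le continuous_snd continuous_const).inter <|
          isClosed_eq (hf.comp continuous_fst) (hf.comp continuous_snd)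
      have : Nonempty c := hne.to_subtype
      obtain ⟨p, hp⟩ := IsCompact.nonempty_iInter_of_directed_nonempty_isCompact_isClosed L (by
          intro A B
          have : ∀ A B : c, A.1 ⊆ B.1 → L A ⊆ L B := fun A B h p hp =>
            ⟨h hp.1, h hp.2.1, hp.2.2⟩
          rcases hch.total A.2 B.2 with h | h
          · exact ⟨A, subset_rfl, this _ _ h⟩
          · exact ⟨B, this _ _ h, subset_rfl⟩) (by
          intro A
          obtain ⟨a, ha, b, hb, hau, hub, hab, hg⟩ := (hc A.2).2.2.2 u
          have hsA : s ∈ A.1 := hs A.1 A.2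
          have htA : t ∈ A.1 := ht A.1 A.2
          by_cases hsa : s ≤ a
          · by_cases hbt : b ≤ t
            · exact ⟨(a, b), ha, hb, hsa, hau, hub, hbt, hab⟩
            · have : t ≤ a := by
                by_contra h
                exact hg t htA (not_le.1 h) (not_le.1 hbt)
              have h2 : u = a := le_antisymm (le_trans htu this) hau
              exact ⟨(a, a), ha, ha, hsa, hau, h2.le, h2 ▸ htu, rfl⟩
          · have : b ≤ s := by
              by_contra h
              exact hg s hsA (not_le.1 hsa) (not_le.1 h)
            have h2 : u = s := le_antisymm (le_trans hub this) hsu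
            exact ⟨(s, s), hsA, hsA, le_rfl, hsu, h2.le, h2 ▸ htu, rfl⟩)
        (fun K => (hLcl K).isCompact) hLcl
      rw [mem_iInter] at hp
      obtain ⟨A0, hA0⟩ := hne
      have hp0 := hp ⟨A0, hA0⟩
      have e1 : p.1 = s := le_antisymm (hsm ⟨fun B hB => (hp ⟨B, hB⟩).1, hp0.2.2.2.1⟩) hp0.2.2.1
      have e2 : p.2 = t := le_antisymm hp0.2.2.2.2.2.1 (htm ⟨fun B hB => (hp ⟨B, hB⟩).2.1, hp0.2.2.2.2.1⟩)
      rw [← e1, ← e2]; exact hp0.2.2.2.2.2.2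
    · intro k hk h1 h2
      rcases le_total k u with h | h
      · exact absurd (hsm ⟨hk, h⟩) (not_le.2 h1)
      · exact absurd (htm ⟨hk, h⟩) (not_le.2 h2)) univ hU
  have hmin : ∀ s ∈ K, ∀ t ∈ K, s < t → f s = f t → ∀ k ∈ K, s < k → k < t → False := by
    intro s hs t ht hst hfst k hk hsk hkt
    have : K \ Ioo s t ∈ S := by
      obtain ⟨hc, h0, h1, h⟩ := hK.1
      refine ⟨hc.sdiff isOpen_Ioo, ⟨h0, fun h => not_lt.2 unitInterval.nonneg' h.1⟩,
        ⟨h1, fun h => not_lt.2 unitInterval.le_one' h.2⟩, fun u => ?_⟩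
      have hsK : s ∈ K \ Ioo s t := ⟨hs, fun h => lt_irrefl _ h.1⟩
      have htK : t ∈ K \ Ioo s t := ⟨ht, fun h => lt_irrefl _ h.2⟩
      by_cases hu : s ≤ u ∧ u ≤ t
      · exact ⟨s, hsK, t, htK, hu.1, hu.2, hfst, fun k hk h1 h2 => hk.2 ⟨h1, h2⟩⟩
      · obtain ⟨a, ha, b, hb, hau, hub, hab, hg⟩ := h u
        have h1 := hg s hs
        have h2 := hg t ht
        have key : b ≤ s ∨ t ≤ a := by
          by_contra! hcon
          rcases lt_or_ge u s with h | h
          · exact h1 (hau.trans_lt h) hcon.1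
          · have : t < u := by
              by_contra h'
              exact hu ⟨h, not_lt.1 h'⟩
            exact h2 hcon.2 (this.trans_le hub)
        refine ⟨a, ⟨ha, ?_⟩, b, ⟨hb, ?_⟩, hau, hub, hab, fun k hk => hg k hk.1⟩
        · rintro ⟨x, y⟩
          rcases key with h | h
          · exact absurd (hau.trans (hub.trans h)) (not_le.2 x)
          · exact absurd h (not_le.2 y)
        · rintro ⟨x, y⟩
          rcases key with h | h
          · exact absurd h (not_le.2 x)
          · exact absurd (h.trans (hau.trans hub)) (not_le.2 y)
    exact (hK.2 this sdiff_subset hk).2 ⟨hsk, hkt⟩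
  obtain ⟨hKc, h0, h1, hKu⟩ := hK.1
  choose a ha b hb hau hub hab hgap using hKu
  -- uniqueness
  have huniq : ∀ u, ∀ s ∈ K, ∀ t ∈ K, s ≤ u → u ≤ t → f s = f t → f s = f (a u) := by
    intro u s hs t ht hsu hut hst
    rcases lt_trichotomy s (a u) with h | h | h
    · rcases lt_or_ge (a u) t with h' | h'
      · exact (hmin s hs t ht (h.trans h') hst _ (ha u) h h').elim
      · have : a u = t := le_antisymm ((hau u).trans hut) h'
        rw [this, hst]
    · rw [h]
    · rcases lt_or_ge s (b u) with h' | h'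
      · exact (hgap u s hs h h').elim
      · have : s = b u := le_antisymm (hsu.trans (hub u)) h'
        rw [this, hab]
  refine ⟨fun u => f (a u), ?_, ?_, ?_, ?_, ?_⟩
  · rw [continuous_iff_isClosed]
    intro C hC
    have : (fun u => f (a u)) ⁻¹' C = Prod.fst '' {p : unitInterval × unitInterval × unitInterval |
        p.2.1 ∈ K ∧ p.2.2 ∈ K ∧ p.2.1 ≤ p.1 ∧ p.1 ≤ p.2.2 ∧ f p.2.1 = f p.2.2 ∧ f p.2.1 ∈ C} := by
      ext u
      constructor
      · intro h
        exact ⟨(u, a u, b u), ⟨ha u, hb u, hau u, hub u, hab u, h⟩, rfl⟩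
      · rintro ⟨⟨u', s, t⟩, ⟨hs, ht, h1, h2, h3, h4⟩, rfl⟩
        show f (a u') ∈ C
        rw [← huniq u' s hs t ht h1 h2 h3]; exact h4
    rw [this]
    refine (IsCompact.image (IsClosed.isCompact ?_) continuous_fst).isClosed
    have c1 : Continuous fun p : unitInterval × unitInterval × unitInterval => p.2.1 := by fun_prop
    have c2 : Continuous fun p : unitInterval × unitInterval × unitInterval => p.2.2 := by fun_prop
    exact (hKc.preimage c1).inter <| (hKc.preimage c2).inter <|
      (isClosed_le c1 continuous_fst).inter <| (isClosed_le continuous_fst c2).inter <|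
      (isClosed_eq (hf.comp c1) (hf.comp c2)).inter <| hC.preimage (hf.comp c1)
  · exact (huniq 0 0 h0 0 h0 le_rfl le_rfl rfl).symm
  · exact (huniq 1 1 h1 1 h1 le_rfl le_rfl rfl).symm
  · rintro _ ⟨u, rfl⟩; exact ⟨_, rfl⟩
  · intro s u t hsu hut hst
    simp only at hst ⊢
    -- a s ≤ u ≤ b t ; f (a s) = f (b t)
    exact (huniq u (a s) (ha s) (b t) (hb t) ((hau s).trans hsu) (hut.trans (hub t))
      (hst.trans (hab t))).symm

theorem arcify {X : Type*} [MetricSpace X] [CompactSpace X] (f : unitInterval → X)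
    (hf : Continuous f) (hne : f 0 ≠ f 1) :
    ∃ γ : unitInterval → X, Continuous γ ∧ Function.Injective γ ∧ γ 0 = f 0 ∧ γ 1 = f 1 ∧
      range γ ⊆ range f := by
  obtain ⟨g, hg, hg0, hg1, hgr, hm⟩ := arc_monotone f hf
  rw [← hg0, ← hg1] at hne ⊢
  suffices h : ∃ γ : unitInterval → X, Continuous γ ∧ Function.Injective γ ∧ γ 0 = g 0 ∧ γ 1 = g 1 ∧
      range γ ⊆ range g by
    obtain ⟨γ, h1, h2, h3, h4, h5⟩ := h
    exact ⟨γ, h1, h2, h3, h4, h5.trans hgr⟩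
  have : Nonempty X := ⟨g 0⟩
  let x : ℕ → X := TopologicalSpace.denseSeq X
  let F : ℕ → unitInterval → unitInterval → ℝ := fun n u r => dist (g (min r u)) (x n)
  let M : ℕ → unitInterval → ℝ := fun n u => sInf (F n u '' univ)
  have hbdd : ∀ n u, BddBelow (F n u '' univ) := fun n u => ⟨0, by
    rintro _ ⟨r, -, rfl⟩; exact dist_nonneg⟩
  have hMle : ∀ n u r, r ≤ u → M n u ≤ dist (g r) (x n) := fun n u r hr =>
    csInf_le (hbdd n u) ⟨r, mem_univ _, by simp [F, min_eq_left hr]⟩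
  have hleM : ∀ n u c, (∀ r ≤ u, c ≤ dist (g r) (x n)) → c ≤ M n u := fun n u c h =>
    le_csInf ⟨_, 0, mem_univ _, rfl⟩ (by
      rintro _ ⟨r, -, rfl⟩; exact h _ (min_le_right _ _))
  have hMc : ∀ n, Continuous (M n) := fun n =>
    isCompact_univ.continuous_sInf (f := F n) (by
      simp only [F, Function.HasUncurry.uncurry, id]; fun_prop)
  have hManti : ∀ n, Antitone (M n) := fun n u v huv =>
    hleM _ _ _ fun r hr => hMle _ _ _ (hr.trans huv)
  have hM0 : ∀ n u, 0 ≤ M n u := fun n u => hleM _ _ _ fun _ _ => dist_nonneg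
  have hMD : ∀ n u, M n u ≤ diam (univ : Set X) := fun n u => (hMle n u u le_rfl).trans
    (dist_le_diam_of_mem isCompact_univ.isBounded (mem_univ _) (mem_univ _))
  let H : unitInterval → ℝ := fun u => ∑' n, (1/2:ℝ)^n * M n u
  have hsumD : Summable fun n : ℕ => (1/2:ℝ)^n * diam (univ : Set X) := summable_geometric_two.mul_right _
  have hbnd : ∀ n u, ‖(1/2:ℝ)^n * M n u‖ ≤ (1/2:ℝ)^n * diam (univ : Set X) := fun n u => by
    rw [Real.norm_of_nonneg (mul_nonneg (by positivity) (hM0 n u))]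
    exact mul_le_mul_of_nonneg_left (hMD n u) (by positivity)
  have hsum : ∀ u, Summable fun n => (1/2:ℝ)^n * M n u := fun u =>
    Summable.of_norm_bounded hsumD (fun n => hbnd n u)
  have hH : Continuous H := continuous_tsum (fun n => continuous_const.mul (hMc n)) hsumD hbnd
  have hHeq : ∀ s t, s ≤ t → g s = g t → H s = H t := by
    intro s t hst h
    refine tsum_congr fun n => ?_
    congr 1
    refine le_antisymm (hleM _ _ _ fun r hr => ?_) (hManti n hst)
    rcases le_total r s with h' | h'
    · exact hMle _ _ _ h'
    · rw [hm s r t h' hr h]; exact hMle _ _ _ le_rfl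
  have hHlt : ∀ s t, s ≤ t → g s ≠ g t → H t < H s := by
    intro s t hst h
    have hnot : g t ∉ g '' Iic s := by
      rintro ⟨r, hr, hrt⟩
      exact h ((hm r s t hr hst hrt).trans hrt)
    have hcomp : IsClosed (g '' Iic s) := (isClosed_Iic.isCompact.image hg).isClosed
    obtain ⟨ε, hε, hball⟩ := Metric.isOpen_iff.1 hcomp.isOpen_compl _ hnot
    obtain ⟨n, hn⟩ := (TopologicalSpace.denseRange_denseSeq X).exists_dist_lt (g t) (half_pos hε)
    refine Summable.tsum_lt_tsum (i := n) (fun k => mul_le_mul_of_nonneg_left (hManti k hst) (by positivity))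
      (mul_lt_mul_of_pos_left ?_ (by positivity)) (hsum t) (hsum s)
    refine ((hMle n t t le_rfl).trans_lt hn).trans_le (hleM _ _ _ fun r hr => ?_)
    by_contra! hlt
    have : g r ∈ ball (g t) ε := by
      rw [mem_ball]
      calc dist (g r) (g t) ≤ dist (g r) (x n) + dist (g t) (x n) := dist_triangle_right _ _ _
        _ < ε := by
          have : dist (g t) (x n) < ε/2 := hn
          linarith
    exact hball this ⟨r, hr, rfl⟩
  have h01 : H 1 < H 0 := hHlt 0 1 unitInterval.nonneg' hne
  have hiff : ∀ s t, H s = H t ↔ g s = g t := by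
    intro s t
    rcases le_total s t with h | h
    · exact ⟨fun e => by by_contra h'; exact (hHlt s t h h').ne' e, hHeq s t h⟩
    · exact ⟨fun e => by by_contra h'; exact (hHlt t s h (Ne.symm h')).ne e, fun e => (hHeq t s h e.symm).symm⟩
  have hHanti : ∀ s t, s ≤ t → H t ≤ H s := fun s t h => by
    by_cases e : g s = g t
    · exact ((hiff s t).2 e).ge
    · exact (hHlt s t h e).le
  let q : unitInterval → unitInterval := fun u => ⟨(H 0 - H u) / (H 0 - H 1), by
    have a1 := hHanti 0 u unitInterval.nonneg'
    have a2 := hHanti u 1 unitInterval.le_one'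
    constructor
    · apply div_nonneg <;> linarith
    · rw [div_le_one] <;> linarith⟩
  have hq : Continuous q := Continuous.subtype_mk (by fun_prop) _
  have hq0 : q 0 = 0 := by ext; simp [q]
  have hq1 : q 1 = 1 := by ext; simp [q, (sub_pos.2 h01).ne']
  have hqs : Function.Surjective q := by
    intro y
    have := intermediate_value_univ (0:unitInterval) 1 hq
    rw [hq0, hq1] at this
    exact this ⟨unitInterval.nonneg', unitInterval.le_one'⟩
  have hqiff : ∀ s t, q s = q t ↔ g s = g t := by
    intro s t
    rw [← hiff, Subtype.ext_iff]
    simp only [q]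
    rw [div_left_inj' (sub_pos.2 h01).ne']
    constructor <;> intro h <;> linarith
  have hquot : Topology.IsQuotientMap q := hq.isClosedMap.isQuotientMap hq hqs
  choose r hr using hqs
  have hfac : (fun y => g (r y)) ∘ q = g := by
    funext u
    exact (hqiff _ _).1 (hr (q u))
  refine ⟨fun y => g (r y), ?_, ?_, ?_, ?_, ?_⟩
  · rw [hquot.continuous_iff, hfac]; exact hg
  · intro y z h
    rw [← hr y, ← hr z]; exact (hqiff _ _).2 h
  · exact (hqiff _ _).1 ((hr 0).trans hq0.symm)
  · exact (hqiff _ _).1 ((hr 1).trans hq1.symm)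
  · rintro _ ⟨y, rfl⟩; exact ⟨_, rfl⟩

def SmallConn {X : Type*} [MetricSpace X] (ε : ℝ) (x y : X) : Prop :=
  ∃ V : Set X, IsPreconnected V ∧ x ∈ V ∧ y ∈ V ∧ ∀ u ∈ V, ∀ v ∈ V, dist u v < ε

theorem exists_small_nhd {X : Type*} [MetricSpace X] [LocallyConnectedSpace X] (x : X) {ε : ℝ}
    (hε : 0 < ε) : ∃ V : Set X, IsOpen V ∧ IsPreconnected V ∧ x ∈ V ∧
      (∀ u ∈ V, ∀ v ∈ V, dist u v < ε) := by
  obtain ⟨V, ⟨hVo, hxV, hVc⟩, hV⟩ := (LocallyConnectedSpace.open_connected_basis x).mem_iff.1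
    (ball_mem_nhds x (half_pos hε))
  refine ⟨V, hVo, hVc.isPreconnected, hxV, fun u hu v hv => ?_⟩
  have h1 := hV hu
  have h2 := hV hv
  simp only [mem_ball] at h1 h2
  have := dist_triangle_right u v x
  linarith

theorem SmallConn.refl {X : Type*} [MetricSpace X] [LocallyConnectedSpace X] {ε : ℝ}
    (hε : 0 < ε) (x : X) : SmallConn ε x x := by
  obtain ⟨V, -, h1, h2, h3⟩ := exists_small_nhd x hε
  exact ⟨V, h1, h2, h2, h3⟩

theorem SmallConn.dist_lt {X : Type*} [MetricSpace X] {ε : ℝ} {x y : X}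
    (h : SmallConn ε x y) : dist x y < ε := by
  obtain ⟨V, -, h1, h2, h3⟩ := h
  exact h3 _ h1 _ h2

theorem chain_in {X : Type*} [MetricSpace X] [LocallyConnectedSpace X] {δ : ℝ}
    (hδ : 0 < δ) (V : Set X) (hV : IsPreconnected V) (x y : X) (hx : x ∈ V) (hy : y ∈ V) :
    ∃ n : ℕ, ∃ z : ℕ → X, z 0 = x ∧ (∀ i, n ≤ i → z i = y) ∧
      (∀ i, SmallConn δ (z i) (z (i+1))) ∧ ∀ i, z i ∈ V := by
  have h : Relation.ReflTransGen (fun u v => SmallConn δ u v ∧ u ∈ V ∧ v ∈ V) x y := by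
    refine hV.induction₂ _ ?_ (fun _ _ _ _ _ _ => Relation.ReflTransGen.trans) ?_ hx hy
    · intro u hu
      obtain ⟨W, hWo, hWc, huW, hW⟩ := exists_small_nhd u hδ
      filter_upwards [mem_nhdsWithin_of_mem_nhds (hWo.mem_nhds huW), self_mem_nhdsWithin] with v hv hvV
      exact Relation.ReflTransGen.single ⟨⟨W, hWc, huW, hv, hW⟩, hu, hvV⟩
    · intro u v _ _ h
      have hsym : Std.Symm (fun u v => SmallConn δ u v ∧ u ∈ V ∧ v ∈ V) := by
        constructor
        rintro a b ⟨⟨W, h1, h2, h3, h4⟩, ha, hb⟩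
        exact ⟨⟨W, h1, h3, h2, h4⟩, hb, ha⟩
      exact (Relation.ReflTransGen.stdSymm).symm _ _ h
  induction h using Relation.ReflTransGen.head_induction_on with
  | refl => exact ⟨0, fun _ => y, rfl, fun _ _ => rfl, fun _ => SmallConn.refl hδ _, fun _ => hy⟩
  | @head a b hab _ ih =>
    obtain ⟨n, z, h0, h1, h2, h3⟩ := ih hab.2.2
    refine ⟨n+1, fun i => Nat.casesOn i a z, rfl, ?_, ?_, ?_⟩
    · rintro (_ | i) hi
      · omega
      · exact h1 i (by omega)
    · rintro (_ | i)
      · show SmallConn δ a (z 0)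
        rw [h0]; exact hab.1
      · exact h2 i
    · rintro (_ | i)
      · exact hab.2.1
      · exact h3 i

theorem uniform_chain {X : Type*} [MetricSpace X] [CompactSpace X] [LocallyConnectedSpace X]
    {ε δ : ℝ} (hε : 0 < ε) (hδ : 0 < δ) (hδε : δ ≤ ε) :
    ∃ n : ℕ, 0 < n ∧ ∀ x y : X, SmallConn ε x y → ∃ z : ℕ → X, z 0 = x ∧ z n = y ∧
      (∀ i, SmallConn δ (z i) (z (i+1))) ∧ ∀ i, dist x (z i) < 3 * ε := by
  have key := (isCompact_univ (X := X × X)).induction_on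
    (p := fun S => ∃ n : ℕ, ∀ p ∈ S, SmallConn ε p.1 p.2 → ∃ z : ℕ → X, z 0 = p.1 ∧
      (∀ i, n ≤ i → z i = p.2) ∧
      (∀ i, SmallConn δ (z i) (z (i+1))) ∧ ∀ i, dist p.1 (z i) < 3 * ε)
    ⟨0, fun p hp => hp.elim⟩
    (fun S T hST ⟨n, hn⟩ => ⟨n, fun p hp => hn p (hST hp)⟩)
    (by
      rintro S T ⟨n, hn⟩ ⟨m, hm⟩
      refine ⟨max n m, fun p hp hs => ?_⟩
      rcases hp with hp | hp
      · obtain ⟨z, h0, h1, h2⟩ := hn p hp hs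
        exact ⟨z, h0, fun i hi => h1 i (le_of_max_le_left hi), h2⟩
      · obtain ⟨z, h0, h1, h2⟩ := hm p hp hs
        exact ⟨z, h0, fun i hi => h1 i (le_of_max_le_right hi), h2⟩)
    (by
      rintro ⟨x, y⟩ -
      obtain ⟨A, hAo, hAc, hxA, hA⟩ := exists_small_nhd x hδ
      obtain ⟨B, hBo, hBc, hyB, hB⟩ := exists_small_nhd y hδ
      refine ⟨A ×ˢ B, mem_nhdsWithin_of_mem_nhds ((hAo.prod hBo).mem_nhds ⟨hxA, hyB⟩), ?_⟩
      by_cases hex : ∃ p ∈ A ×ˢ B, SmallConn ε p.1 p.2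
      · obtain ⟨⟨x0, y0⟩, ⟨hx0, hy0⟩, V, hVc, hxV, hyV, hV⟩ := hex
        simp only at hx0 hy0 hxV hyV
        obtain ⟨n, z, h0, h1, h2, h3⟩ := chain_in hδ V hVc x0 y0 hxV hyV
        refine ⟨n + 2, ?_⟩
        rintro ⟨x', y'⟩ ⟨hx', hy'⟩ hs
        simp only at hx' hy' hs ⊢
        refine ⟨fun i => if i = 0 then x' else if i ≤ n + 1 then z (i-1) else y', by simp, ?_, ?_, ?_⟩
        · intro i hi
          beta_reduce
          rw [if_neg (by omega), if_neg (by omega)]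
        · intro i
          by_cases hi0 : i = 0
          · subst hi0
            simp only [zero_add, if_true, one_ne_zero, if_false]
            rw [if_pos (by omega)]
            simp only [Nat.sub_self, h0]
            exact ⟨A, hAc, hx', hx0, hA⟩
          · beta_reduce
            rw [if_neg hi0, if_neg (show ¬ (i + 1 = 0) by omega)]
            by_cases hi1 : i ≤ n
            · rw [if_pos (show i ≤ n + 1 by omega), if_pos (show i + 1 ≤ n + 1 by omega)]
              obtain ⟨j, rfl⟩ := Nat.exists_eq_succ_of_ne_zero hi0
              exact h2 j
            · rw [if_neg (show ¬ (i + 1 ≤ n + 1) by omega)]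
              split_ifs with h
              · rw [h1 _ (by omega)]
                exact ⟨B, hBc, hy0, hy', hB⟩
              · exact SmallConn.refl hδ _
        · intro i
          simp only
          split_ifs
          · rw [dist_self]; linarith
          · have e1 := hA x' hx' x0 hx0
            have e2 := hV x0 hxV _ (h3 (i-1))
            have e3 := dist_triangle x' x0 (z (i-1))
            linarith
          · have := hs.dist_lt
            linarith
      · exact ⟨0, fun p hp hs => (hex ⟨p, hp, hs⟩).elim⟩)
  obtain ⟨n, hn⟩ := key
  refine ⟨n + 1, by omega, fun x y hs => ?_⟩
  obtain ⟨z, h0, h1, h2⟩ := hn (x, y) (mem_univ _) hs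
  exact ⟨z, h0, h1 _ (by omega), h2⟩

theorem small_path {X : Type*} [MetricSpace X] [CompactSpace X] [LocallyConnectedSpace X]
    {ε : ℝ} (hε : 0 < ε) (a b : X) (hab : SmallConn ε a b) :
    ∃ f : ℝ → X, Continuous (fun t : unitInterval => f t) ∧ f 0 = a ∧ f 1 = b ∧
      ∀ t : unitInterval, dist a (f t) < 8 * ε := by
  let e : ℕ → ℝ := fun k => ε / 2 ^ k
  have he : ∀ k, 0 < e k := fun k => by positivity
  have hee : ∀ k, e (k+1) = e k / 2 := fun k => by simp only [e, pow_succ]; field_simp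
  have hstep := fun k => uniform_chain (X := X) (he k) (he (k+1)) (by rw [hee]; linarith [he k])
  choose m hm0 hm using hstep
  have hZ : ∀ k, ∃ Z : X → X → ℕ → X, ∀ x y, SmallConn (e k) x y → Z x y 0 = x ∧ Z x y (m k) = y ∧
      (∀ i, SmallConn (e (k+1)) (Z x y i) (Z x y (i+1))) ∧ ∀ i, dist x (Z x y i) < 3 * e k := by
    intro k
    classical
    refine ⟨fun x y => if h : SmallConn (e k) x y then Classical.choose (hm k x y h) else fun _ => x, ?_⟩
    intro x y h
    simp only [dif_pos h]
    exact Classical.choose_spec (hm k x y h)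
  choose Z hZ using hZ
  let P : ℕ → ℕ → X := fun k => Nat.rec (fun i => if i = 0 then a else b)
    (fun k Q i => Z k (Q (i / m k)) (Q (i / m k + 1)) (i % m k)) k
  have hP0 : ∀ i, P 0 i = if i = 0 then a else b := fun i => rfl
  have hPs : ∀ k i, P (k+1) i = Z k (P k (i / m k)) (P k (i / m k + 1)) (i % m k) := fun k i => rfl
  have hPR : ∀ k i, SmallConn (e k) (P k i) (P k (i+1)) := by
    intro k
    induction k with
    | zero =>
      intro i
      have : e 0 = ε := by simp [e]
      rw [hP0, hP0, this, if_neg (Nat.succ_ne_zero i)]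
      split_ifs
      · exact hab
      · exact SmallConn.refl hε _
    | succ k ih =>
      intro i
      have hz := hZ k _ _ (ih (i / m k))
      rw [hPs, hPs]
      have hlt := Nat.mod_lt i (hm0 k)
      have hdm := Nat.div_add_mod i (m k)
      by_cases h : i % m k + 1 < m k
      · have h1 : (i+1) / m k = i / m k := by
          rw [Nat.div_eq_iff (hm0 k)]
          constructor
          · rw [mul_comm]; omega
          · rw [mul_comm]; omega
        have h2 : (i+1) % m k = i % m k + 1 := by
          have := Nat.div_add_mod (i+1) (m k)
          rw [h1] at this; omega
        rw [h1, h2]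
        exact hz.2.2.1 _
      · have h0 : i + 1 = m k * (i / m k + 1) := by rw [mul_add]; omega
        have h1 : (i+1) / m k = i / m k + 1 := by rw [h0, Nat.mul_div_cancel_left _ (hm0 k)]
        have h2 : (i+1) % m k = 0 := by rw [h0, Nat.mul_mod_right]
        rw [h1, h2, (hZ k _ _ (ih (i / m k + 1))).1]
        have h3 := hz.2.2.1 (i % m k)
        rwa [show i % m k + 1 = m k by omega, hz.2.1] at h3
  have hPd : ∀ k i, dist (P k (i / m k)) (P (k+1) i) < 3 * e k := fun k i => by
    rw [hPs]; exact (hZ k _ _ (hPR k _)).2.2.2 _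
  let N : ℕ → ℕ := fun k => ∏ j ∈ Finset.range k, m j
  have hN0 : N 0 = 1 := by simp [N]
  have hNs : ∀ k, N (k+1) = N k * m k := fun k => Finset.prod_range_succ _ _
  have hNpos : ∀ k, 0 < N k := fun k => Finset.prod_pos fun j _ => hm0 j
  let F : ℝ → ℕ → X := fun t k => P k ⌊t * N k⌋₊
  have hFd : ∀ t k, dist (F t k) (F t (k+1)) < 3 * e k := by
    intro t k
    have h : ⌊t * N k⌋₊ = ⌊t * N (k+1)⌋₊ / m k := by
      rw [← Nat.floor_div_natCast]
      congr 1
      rw [hNs]; push_cast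
      have : (m k : ℝ) ≠ 0 := by exact_mod_cast (hm0 k).ne'
      field_simp
    simp only [F]
    rw [h]; exact hPd _ _
  have hFd' : ∀ t k, dist (F t k) (F t (k+1)) ≤ (6 * ε) / 2 / 2 ^ k := fun t k => by
    refine (hFd t k).le.trans (le_of_eq ?_)
    simp only [e]; ring
  have hlim : ∀ t, ∃ x, Tendsto (F t) atTop (nhds x) := fun t =>
    cauchySeq_tendsto_of_complete (cauchySeq_of_le_geometric_two (hFd' t))
  choose f hf using hlim
  have hfF : ∀ t k, dist (F t k) (f t) ≤ 6 * e k := fun t k => by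
    refine (dist_le_of_le_geometric_two_of_tendsto (hFd' t) (hf t) k).trans (le_of_eq ?_)
    simp only [e]; ring
  have hZ0 : ∀ k, P k 0 = a := by
    intro k
    induction k with
    | zero => simp [hP0]
    | succ k ih => rw [hPs, Nat.zero_div, Nat.zero_mod, (hZ k _ _ (hPR k _)).1, ih]
  have hZ1 : ∀ k, P k (N k) = b := by
    intro k
    induction k with
    | zero => simp [hP0, hN0]
    | succ k ih => rw [hPs, hNs, Nat.mul_div_cancel _ (hm0 k), Nat.mul_mod_left, (hZ k _ _ (hPR k _)).1, ih]
  refine ⟨f, ?_, ?_, ?_, ?_⟩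
  · rw [Metric.continuous_iff]
    intro t η hη
    obtain ⟨k, hk⟩ : ∃ k, 13 * e k < η := by
      obtain ⟨k, hk⟩ := exists_pow_lt_of_lt_one (show 0 < η / (13 * ε) by positivity) (show (1/2:ℝ) < 1 by norm_num)
      refine ⟨k, ?_⟩
      rw [lt_div_iff₀ (by positivity)] at hk
      calc 13 * e k = (1/2)^k * (13 * ε) := by simp only [e, one_div, inv_pow]; ring
        _ < η := hk
    have hNk : (0:ℝ) < N k := by exact_mod_cast hNpos k
    refine ⟨1 / N k, by positivity, fun s hs => ?_⟩
    have hd : dist (F s k) (F t k) < e k := by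
      have hs' : |(s:ℝ) - t| < 1 / N k := hs
      rw [lt_div_iff₀ hNk] at hs'
      have habs : |(s:ℝ) * N k - t * N k| < 1 := by
        rw [← sub_mul, abs_mul, abs_of_pos hNk]; exact hs'
      rw [abs_lt] at habs
      have b1 := Nat.floor_le (show (0:ℝ) ≤ s * N k from mul_nonneg s.2.1 hNk.le)
      have b2 := Nat.lt_floor_add_one ((s:ℝ) * N k)
      have b3 := Nat.floor_le (show (0:ℝ) ≤ t * N k from mul_nonneg t.2.1 hNk.le)
      have b4 := Nat.lt_floor_add_one ((t:ℝ) * N k)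
      have c1 : ⌊(s:ℝ) * N k⌋₊ < ⌊(t:ℝ) * N k⌋₊ + 2 := by
        have : (⌊(s:ℝ) * N k⌋₊ : ℝ) < ⌊(t:ℝ) * N k⌋₊ + 2 := by linarith
        exact_mod_cast this
      have c2 : ⌊(t:ℝ) * N k⌋₊ < ⌊(s:ℝ) * N k⌋₊ + 2 := by
        have : (⌊(t:ℝ) * N k⌋₊ : ℝ) < ⌊(s:ℝ) * N k⌋₊ + 2 := by linarith
        exact_mod_cast this
      have c3 : ⌊(s:ℝ) * N k⌋₊ = ⌊(t:ℝ) * N k⌋₊ ∨ ⌊(s:ℝ) * N k⌋₊ = ⌊(t:ℝ) * N k⌋₊ + 1 ∨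
        ⌊(t:ℝ) * N k⌋₊ = ⌊(s:ℝ) * N k⌋₊ + 1 := by omega
      simp only [F]
      rcases c3 with h | h | h
      · rw [h, dist_self]; exact he k
      · rw [h, dist_comm]; exact (hPR k _).dist_lt
      · rw [h]; exact (hPR k _).dist_lt
    have d1 := hfF s k
    have d2 := hfF t k
    have d3 := dist_triangle4_left (f s) (f t) (F s k) (F t k)
    rw [dist_comm] at d1
    have d3 := dist_triangle4 (f s) (F s k) (F t k) (f t)
    linarith
  · refine tendsto_nhds_unique (hf 0) ?_
    simp only [F, zero_mul, Nat.floor_zero, hZ0]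
    exact tendsto_const_nhds
  · refine tendsto_nhds_unique (hf 1) ?_
    simp only [F, one_mul, Nat.floor_natCast, hZ1]
    exact tendsto_const_nhds
  · intro t
    have h1 := hfF t 0
    have h2 : dist a (F t 0) < ε := by
      simp only [F, hP0]
      split_ifs
      · rw [dist_self]; exact hε
      · exact hab.dist_lt
    have h3 := dist_triangle a (F t 0) (f t)
    have : e 0 = ε := by simp [e]
    rw [this] at h1
    linarith

theorem locPath {X : Type*} [MetricSpace X] [CompactSpace X] [LocallyConnectedSpace X] :
    LocallyPathConnectedSpace X := by
  refine ⟨fun x => ?_⟩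
  rw [hasBasis_self]
  intro s hs
  obtain ⟨r, hr, hrs⟩ := Metric.mem_nhds_iff.1 hs
  have hr8 : 0 < r / 8 := by positivity
  refine ⟨pathComponentIn (ball x r) x, ?_, isPathConnected_pathComponentIn (mem_ball_self hr),
    pathComponentIn_subset.trans hrs⟩
  obtain ⟨V, hVo, hVc, hxV, hV⟩ := exists_small_nhd x hr8
  refine mem_of_superset (hVo.mem_nhds hxV) fun y hy => ?_
  obtain ⟨f, hf, h0, h1, h2⟩ := small_path hr8 x y ⟨V, hVc, hxV, hy, hV⟩
  refine ⟨⟨⟨fun t => f t, hf⟩, by simpa using h0, by simpa using h1⟩, fun t => ?_⟩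
  rw [mem_ball']
  have := h2 t
  show dist x (f t) < r
  linarith

theorem circle_of_arcs {X : Type*} [MetricSpace X] (α β : unitInterval → X)
    (hα : Continuous α) (hβ : Continuous β) (iα : Function.Injective α) (iβ : Function.Injective β)
    (h0 : α 0 = β 0) (h1 : α 1 = β 1)
    (hint : ∀ s t, α s = β t → s = 0 ∨ s = 1) :
    ∃ s : Set X, Nonempty (s ≃ₜ (Metric.sphere (0 : ℂ) 1 : Set ℂ)) := by
  have h01 : (0:ℝ) ≤ 1 := zero_le_one
  let h : ℝ → X := fun t => if t ≤ 1 then α (projIcc 0 1 h01 t) else β (projIcc 0 1 h01 (2 - t))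
  have hc : Continuous h := by
    refine Continuous.if_le (hα.comp continuous_projIcc)
      (hβ.comp (continuous_projIcc.comp (by fun_prop))) continuous_id continuous_const ?_
    intro x hx
    subst hx
    rw [show (2:ℝ) - 1 = 1 by norm_num, projIcc_right]
    exact h1
  have hh : h 0 = h 2 := by
    simp only [h]
    rw [if_pos zero_le_one, if_neg (by norm_num), sub_self, projIcc_left]
    exact h0
  have hinj : InjOn h (Ico 0 2) := by
    have cross : ∀ x y : ℝ, 0 ≤ x → x ≤ 1 → 1 < y → y < 2 → h x = h y → False := by
      intro x y hx0 hx1 hy1 hy2 hxy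
      simp only [h] at hxy
      rw [if_pos hx1, if_neg (not_le.2 hy1)] at hxy
      rw [projIcc_of_mem h01 ⟨hx0, hx1⟩, projIcc_of_mem h01 (show 2 - y ∈ Icc (0:ℝ) 1 by constructor <;> linarith)] at hxy
      rcases hint _ _ hxy with e | e
      · rw [e, h0] at hxy
        have := congrArg Subtype.val (iβ hxy)
        simp at this; linarith
      · rw [e, h1] at hxy
        have := congrArg Subtype.val (iβ hxy)
        simp at this; linarith
    intro x hx y hy hxy
    rcases le_or_gt x 1 with hx1 | hx1 <;> rcases le_or_gt y 1 with hy1 | hy1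
    · simp only [h, if_pos hx1, if_pos hy1] at hxy
      rw [projIcc_of_mem h01 ⟨hx.1, hx1⟩, projIcc_of_mem h01 ⟨hy.1, hy1⟩] at hxy
      exact congrArg Subtype.val (iα hxy)
    · exact (cross x y hx.1 hx1 hy1 hy.2 hxy).elim
    · exact (cross y x hy.1 hy1 hx1 hx.2 hxy.symm).elim
    · simp only [h, if_neg (not_le.2 hx1), if_neg (not_le.2 hy1)] at hxy
      have mx : 2 - x ∈ Icc (0:ℝ) 1 := by have := hx.2; constructor <;> linarith
      have my : 2 - y ∈ Icc (0:ℝ) 1 := by have := hy.2; constructor <;> linarith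
      rw [projIcc_of_mem h01 mx, projIcc_of_mem h01 my] at hxy
      have := congrArg Subtype.val (iβ hxy)
      simp at this; linarith
  have : Fact (0 < (2:ℝ)) := ⟨two_pos⟩
  let L : AddCircle (2:ℝ) → X := AddCircle.liftIco 2 0 h
  have hLc : Continuous L := AddCircle.liftIco_zero_continuous hh hc.continuousOn
  have hLi : Function.Injective L := by
    intro x y hxy
    obtain ⟨x, hx, rfl⟩ := AddCircle.eq_coe_Ico x
    obtain ⟨y, hy, rfl⟩ := AddCircle.eq_coe_Ico y
    simp only [L] at hxy
    rw [AddCircle.liftIco_zero_coe_apply hx, AddCircle.liftIco_zero_coe_apply hy] at hxy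
    rw [hinj hx hy hxy]
  have hemb : Topology.IsEmbedding L := (hLc.isClosedEmbedding hLi).isEmbedding
  have e1 : Circle ≃ₜ (Metric.sphere (0 : ℂ) 1 : Set ℂ) := Homeomorph.refl _
  exact ⟨range L, ⟨hemb.toHomeomorph.symm.trans ((AddCircle.homeomorphCircle two_ne_zero).trans e1)⟩⟩

theorem no_bypass {X : Type*} [MetricSpace X] [CompactSpace X]
    (hX : ∀ s : Set X, ¬ Nonempty (s ≃ₜ (Metric.sphere (0 : ℂ) 1 : Set ℂ)))
    (γ g : unitInterval → X) (hγ : Continuous γ) (iγ : Function.Injective γ) (hg : Continuous g)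
    (h0 : g 0 = γ 0) (h1 : g 1 = γ 1) (c : unitInterval) (hc : ∀ t, g t ≠ γ c) : False := by
  have cl1 : IsClosed (g ⁻¹' (γ '' Iic c)) :=
    (isClosed_Iic.isCompact.image hγ).isClosed.preimage hg
  have cl2 : IsClosed (g ⁻¹' (γ '' Ici c)) :=
    (isClosed_Ici.isCompact.image hγ).isClosed.preimage hg
  obtain ⟨u, ⟨s, hsc, hsu⟩, hum⟩ := cl1.isCompact.exists_isGreatest
    ⟨0, 0, unitInterval.nonneg', h0.symm⟩
  obtain ⟨v, ⟨⟨t, htc, htv⟩, huv⟩, hvm⟩ := (cl2.inter (isClosed_Ici (a := u))).isCompact.exists_isLeast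
    ⟨1, ⟨1, unitInterval.le_one', h1.symm⟩, unitInterval.le_one'⟩
  simp only [mem_Iic, mem_Ici] at hsc htc huv
  have hsc' : s < c := lt_of_le_of_ne hsc (by rintro rfl; exact hc u hsu.symm)
  have htc' : c < t := lt_of_le_of_ne htc (by rintro rfl; exact hc v htv.symm)
  have hst : s ≤ t := (hsc'.trans htc').le
  have hne : γ s ≠ γ t := fun h => (hsc'.trans htc').ne (iγ h)
  obtain ⟨α, cα, iα, α0, α1, rα⟩ := arcify (fun r => γ (projIcc s t hst r))
    (hγ.comp (continuous_subtype_val.comp continuous_projIcc)) (by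
      rw [projIcc_of_le_left _ unitInterval.nonneg', projIcc_of_right_le _ unitInterval.le_one']
      exact hne)
  obtain ⟨β, cβ, iβ, β0, β1, rβ⟩ := arcify (fun r => g (projIcc u v huv r))
    (hg.comp (continuous_subtype_val.comp continuous_projIcc)) (by
      rw [projIcc_of_le_left _ unitInterval.nonneg', projIcc_of_right_le _ unitInterval.le_one']
      simp only
      rw [← hsu, ← htv]
      exact hne)
  rw [projIcc_of_le_left _ unitInterval.nonneg'] at α0 β0
  rw [projIcc_of_right_le _ unitInterval.le_one'] at α1 β1
  simp only at α0 α1 β0 β1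
  rw [← hsu] at β0
  rw [← htv] at β1
  obtain ⟨S, hS⟩ := circle_of_arcs α β cα cβ iα iβ (α0.trans β0.symm) (α1.trans β1.symm) (by
    intro a b hab
    obtain ⟨w, hw⟩ := rβ ⟨b, rfl⟩
    obtain ⟨r, hr⟩ := rα ⟨a, rfl⟩
    simp only at hw hr
    set w' := projIcc u v huv w
    set r' := projIcc s t hst r
    have hgw : γ r' = g w' := by rw [hw, hr, hab]
    rcases le_total (r' : unitInterval) c with h | h
    · left
      have : (w' : unitInterval) = u := le_antisymm (hum ⟨r', h, hgw⟩) w'.2.1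
      apply iα
      rw [← hr, hgw, this, α0, hsu]
    · right
      have : (w' : unitInterval) = v := le_antisymm w'.2.2 (hvm ⟨⟨r', h, hgw⟩, w'.2.1⟩)
      apply iα
      rw [← hr, hgw, this, α1, htv])
  exact hX S hS

theorem stmt10 {X : Type*} [MetricSpace X] (hX : IsDendrite X)
    (C₁ C₂ : Set X) (h₁ : IsConnected C₁) (h₂ : IsConnected C₂)
    (hdisj : Disjoint C₁ C₂) :
    (closure C₁ ∩ closure C₂).Subsingleton := by
  obtain ⟨hcomp, hconn, hloc, hno⟩ := hX
  have hlp : LocallyPathConnectedSpace X := locPath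
  have key : ∀ γ : unitInterval → X, Continuous γ → Function.Injective γ → ∀ C : Set X,
      IsPreconnected C → γ 0 ∈ C → γ 1 ∈ C → range γ ⊆ C := by
    rintro γ hγ iγ C hC h0 h1 _ ⟨c, rfl⟩
    by_contra hc
    have hsub : C ⊆ ({γ c}ᶜ : Set X) := fun x hx h => hc (h ▸ hx)
    have hop : IsOpen (connectedComponentIn ({γ c}ᶜ : Set X) (γ 0)) :=
      isOpen_compl_singleton.connectedComponentIn
    have hcc : IsConnected (connectedComponentIn ({γ c}ᶜ : Set X) (γ 0)) :=
      isConnected_connectedComponentIn_iff.2 (hsub h0)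
    have hCs := hC.subset_connectedComponentIn h0 hsub
    obtain ⟨p, hp⟩ := (hop.isConnected_iff_isPathConnected.1 hcc).joinedIn _ (hCs h0) _ (hCs h1)
    exact no_bypass hno γ p hγ iγ p.continuous p.source p.target c
      fun t ht => connectedComponentIn_subset _ _ (hp t) ht
  rintro x ⟨hx1, hx2⟩ y ⟨hy1, hy2⟩
  by_contra hxy
  obtain ⟨U', V', hU', hV', hxU', hyV', hUV'⟩ := t2_separation hxy
  obtain ⟨U, ⟨hUo, hxU, hUc⟩, hU⟩ := (LocallyConnectedSpace.open_connected_basis x).mem_iff.1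
    (hU'.mem_nhds hxU')
  obtain ⟨V, ⟨hVo, hyV, hVc⟩, hV⟩ := (LocallyConnectedSpace.open_connected_basis y).mem_iff.1
    (hV'.mem_nhds hyV')
  simp only [id] at hU hV
  have hUV : Disjoint U V := hUV'.mono hU hV
  obtain ⟨p, hpU, hp1⟩ := mem_closure_iff.1 hx1 U hUo hxU
  obtain ⟨p2, hp2U, hp2⟩ := mem_closure_iff.1 hx2 U hUo hxU
  obtain ⟨q, hqV, hq1⟩ := mem_closure_iff.1 hy1 V hVo hyV
  obtain ⟨q2, hq2V, hq2⟩ := mem_closure_iff.1 hy2 V hVo hyV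
  have hD : IsPreconnected ((U ∪ C₂) ∪ V) :=
    IsPreconnected.union q2 (Or.inr hq2) hq2V
      (IsPreconnected.union p2 hp2U hp2 hUc.isPreconnected h₂.isPreconnected) hVc.isPreconnected
  have hpq : p ≠ q := fun h => disjoint_left.1 hUV hpU (h ▸ hqV)
  have hpc : IsPathConnected (univ : Set X) :=
    isOpen_univ.isConnected_iff_isPathConnected.1 isConnected_univ
  obtain ⟨f, -⟩ := hpc.joinedIn p (mem_univ _) q (mem_univ _)
  obtain ⟨γ, cγ, iγ, γ0, γ1, -⟩ := arcify f f.continuous (by rw [f.source, f.target]; exact hpq)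
  rw [f.source] at γ0
  rw [f.target] at γ1
  have r1 := key γ cγ iγ C₁ h₁.isPreconnected (γ0 ▸ hp1) (γ1 ▸ hq1)
  have r2 := key γ cγ iγ _ hD (γ0 ▸ Or.inl (Or.inl hpU)) (γ1 ▸ Or.inr hqV)
  have hrc : IsPreconnected (range γ) := isPreconnected_range cγ
  obtain ⟨z, -, hzU, hzV⟩ := hrc U V hUo hVo (by
    intro z hz
    rcases r2 hz with (h | h) | h
    · exact Or.inl h
    · exact (disjoint_left.1 hdisj (r1 hz) h).elim
    · exact Or.inr h) ⟨p, ⟨0, γ0⟩, hpU⟩ ⟨q, ⟨1, γ1⟩, hqV⟩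
  exact disjoint_left.1 hUV hzU hzV
end

section
/- Let X be a dendrite and x, y ∈ X with x ≠ y. Then there exist ε > 0 and a nondegenerate arc J ⊆ [x, y] such that for all u ∈ B(x, ε) and v ∈ B(y, ε), J ⊆ [u, v]. -/
open Set Metric Filter

section
variable {X : Type*} [MetricSpace X]

lemma dd_chain {V : Set X} (hV : IsPreconnected V) {η : ℝ} (hη : 0 < η) {a b : X}
    (ha : a ∈ V) (hb : b ∈ V) :
    ∃ (N : ℕ) (c : ℕ → X), c 0 = a ∧ (∀ j, N ≤ j → c j = b) ∧ (∀ j, c j ∈ V) ∧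
      ∀ j, dist (c j) (c (j+1)) < η := by
  have key : (∃ (N : ℕ) (c : ℕ → X), c 0 = a ∧ (∀ j, N ≤ j → c j = b) ∧
      (∀ j, c j ∈ V) ∧ ∀ j, dist (c j) (c (j+1)) < η) := by
    have tr : ∀ a b d : X, a ∈ V → b ∈ V → d ∈ V → 
      (∃ (N : ℕ) (c : ℕ → X), c 0 = a ∧ (∀ j, N ≤ j → c j = b) ∧
      (∀ j, c j ∈ V) ∧ ∀ j, dist (c j) (c (j+1)) < η) → 
      (∃ (N : ℕ) (c : ℕ → X), c 0 = b ∧ (∀ j, N ≤ j → c j = d) ∧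
      (∀ j, c j ∈ V) ∧ ∀ j, dist (c j) (c (j+1)) < η) → 
      (∃ (N : ℕ) (c : ℕ → X), c 0 = a ∧ (∀ j, N ≤ j → c j = d) ∧
      (∀ j, c j ∈ V) ∧ ∀ j, dist (c j) (c (j+1)) < η) := by
      rintro a b d - - - ⟨N, c, h0, h1, h2, h3⟩ ⟨N', c', h0', h1', h2', h3'⟩
      refine ⟨N + N', fun j => if j < N then c j else c' (j - N), ?_, ?_, ?_, ?_⟩
      · by_cases h : 0 < N
        · simp [h, h0]
        · have : N = 0 := by omega
          subst this
          simp [h0', ← h0, h1 0 le_rfl]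
      · intro j hj
        have : ¬ j < N := by omega
        simp only [this, if_false]
        exact h1' _ (by omega)
      · intro j
        dsimp only
        split_ifs
        · exact h2 _
        · exact h2' _
      · intro j
        dsimp only
        by_cases h : j + 1 < N
        · rw [if_pos (by omega), if_pos h]; exact h3 j
        · by_cases h' : j < N
          · rw [if_pos h', if_neg h]
            have e : j + 1 = N := by omega
            have := h3 j
            rw [h1 (j+1) (by omega)] at this
            rwa [e, Nat.sub_self, h0']
          · rw [if_neg h', if_neg h]
            have e : j + 1 - N = (j - N) + 1 := by omega
            rw [e]; exact h3' _
    refine hV.induction₂' (fun a b : X => ∃ (N : ℕ) (c : ℕ → X), c 0 = a ∧ (∀ j, N ≤ j → c j = b) ∧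
      (∀ j, c j ∈ V) ∧ ∀ j, dist (c j) (c (j+1)) < η) ?_ ?_ ha hb
    · intro p hp
      filter_upwards [inter_mem_nhdsWithin V (ball_mem_nhds p hη)] with q hq
      have : dist p q < η := by rw [dist_comm]; exact hq.2
      constructor
      · refine ⟨1, fun j => if j = 0 then p else q, by simp, ?_, ?_, ?_⟩
        · intro j hj
          have : j ≠ 0 := by omega
          simp [this]
        · intro j; dsimp only; split_ifs
          exacts [hp, hq.1]
        · rintro (_ | j)
          · simpa using this
          · simpa using hη
      · refine ⟨1, fun j => if j = 0 then q else p, by simp, ?_, ?_, ?_⟩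
        · intro j hj
          have : j ≠ 0 := by omega
          simp [this]
        · intro j; dsimp only; split_ifs
          exacts [hq.1, hp]
        · rintro (_ | j)
          · simpa [dist_comm] using this
          · simpa using hη
    · intro a b d ha hb hd h1 h2
      exact tr a b d ha hb hd h1 h2
  exact key

lemma dd_unif [CompactSpace X] [LocallyConnectedSpace X] {ε : ℝ} (hε : 0 < ε) :
    ∃ δ > 0, ∀ a b : X, dist a b < δ → ∀ η > 0, ∃ (N : ℕ) (c : ℕ → X), c 0 = a ∧
      (∀ j, N ≤ j → c j = b) ∧ (∀ j, dist a (c j) ≤ ε) ∧ ∀ j, dist (c j) (c (j+1)) < η := by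
  have h : ∀ z : X, ∃ V : Set X, V ⊆ ball z (ε/2) ∧ IsOpen V ∧ z ∈ V ∧ IsConnected V := by
    intro z
    obtain ⟨V, h1, h2⟩ := locallyConnectedSpace_iff_subsets_isOpen_isConnected.1 ‹_› z _
      (ball_mem_nhds z (half_pos hε))
    exact ⟨V, h1, h2⟩
  choose V h1 h2 h3 h4 using h
  obtain ⟨δ, hδ, H⟩ := lebesgue_number_lemma_of_metric (isCompact_univ (X := X)) h2
    (fun z _ => mem_iUnion.2 ⟨z, h3 z⟩)
  refine ⟨δ, hδ, fun a b hab η hη => ?_⟩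
  obtain ⟨z, hz⟩ := H a (mem_univ _)
  obtain ⟨N, c, k0, k1, k2, k3⟩ := dd_chain (h4 z).isPreconnected hη (hz (mem_ball_self hδ))
    (hz (by rwa [mem_ball, dist_comm] : b ∈ ball a δ))
  refine ⟨N, c, k0, k1, fun j => ?_, k3⟩
  have e1 := h1 z (k2 j)
  have e2 := h1 z (k2 0)
  rw [k0] at e2
  rw [mem_ball] at e1 e2
  have := dist_triangle_right a (c j) z
  linarith

lemma dd_step {δ e η : ℝ} (hη : 0 < η) (he : 0 ≤ e)
    (H : ∀ a b : X, dist a b < δ → ∀ η > 0, ∃ (N : ℕ) (c : ℕ → X), c 0 = a ∧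
      (∀ j, N ≤ j → c j = b) ∧ (∀ j, dist a (c j) ≤ e) ∧ ∀ j, dist (c j) (c (j+1)) < η)
    (a b : X) (M : ℕ) (f : ℕ → X) (f0 : f 0 = a) (f1 : ∀ k, M ≤ k → f k = b)
    (f2 : ∀ k, dist (f k) (f (k+1)) < δ) :
    ∃ (N : ℕ) (g : ℕ → X), 1 ≤ N ∧ g 0 = a ∧ (∀ k, M * N ≤ k → g k = b) ∧
      (∀ k, dist (g k) (g (k+1)) < η) ∧ ∀ k, dist (f (k / N)) (g k) ≤ e := by
  have : ∀ k, ∃ (N : ℕ) (c : ℕ → X), c 0 = f k ∧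
      (∀ j, N ≤ j → c j = f (k+1)) ∧ (∀ j, dist (f k) (c j) ≤ e) ∧
      (∀ j, dist (c j) (c (j+1)) < η) ∧ (M ≤ k → N = 0 ∧ ∀ j, c j = b) := by
    intro k
    by_cases hk : M ≤ k
    · refine ⟨0, fun _ => b, ?_, ?_, ?_, ?_, ?_⟩
      · exact (f1 k hk).symm
      · intro j _; exact (f1 (k+1) (by omega)).symm
      · intro j; rw [f1 k hk]; simpa
      · simpa
      · simp
    · obtain ⟨N, c, h⟩ := H _ _ (f2 k) η hη
      exact ⟨N, c, h.1, h.2.1, h.2.2.1, h.2.2.2, fun h => absurd h hk⟩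
  choose N c h0 h1 h2 h3 h4 using this
  set L := (Finset.range M).sup N + 1 with hL
  have hNL : ∀ k, N k ≤ L := by
    intro k
    by_cases hk : M ≤ k
    · rw [(h4 k hk).1]; omega
    · have := Finset.le_sup (f := N) (Finset.mem_range.2 (not_le.1 hk)); omega
  have hL0 : 0 < L := by omega
  refine ⟨L, fun k => c (k / L) (k % L), by omega, by simp [h0, f0], ?_, ?_, ?_⟩
  · intro k hk
    exact (h4 _ ((Nat.le_div_iff_mul_le hL0).2 hk)).2 _
  · intro k
    have : c ((k+1) / L) ((k+1) % L) = c (k / L) (k % L + 1) := by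
      by_cases hk : k % L + 1 < L
      · have e := Nat.div_add_mod k L
        have : (k+1) / L = k / L ∧ (k+1) % L = k % L + 1 := by
          rw [Nat.div_mod_unique hL0]
          omega
        rw [this.1, this.2]
      · have hlt := Nat.mod_lt k hL0
        have e := Nat.div_add_mod k L
        have : (k+1) / L = k / L + 1 ∧ (k+1) % L = 0 := by
          rw [Nat.div_mod_unique hL0, Nat.mul_add]
          omega
        rw [this.1, this.2, h0, h1]
        have := hNL (k / L); omega
    dsimp only
    rw [this]
    exact h3 _ _
  · intro k; exact h2 _ _

lemma dd_path [CompactSpace X] [LocallyConnectedSpace X] {r : ℝ} (hr : 0 < r) :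
    ∃ δ > 0, ∀ a b : X, dist a b < δ → ∃ γ : ℝ → X, Continuous γ ∧ γ 0 = a ∧ γ 1 = b ∧
      ∀ t, dist a (γ t) ≤ r := by
  let e : ℕ → ℝ := fun n => r / 2 / 2 / 2 ^ n
  have he : ∀ n, 0 < e n := fun n => by positivity
  have := fun n => dd_unif (X := X) (he n)
  choose δ₀ hδ₀ H₀ using this
  let δ : ℕ → ℝ := fun n => min (δ₀ n) (e n)
  have hδ : ∀ n, 0 < δ n := fun n => lt_min (hδ₀ n) (he n)
  refine ⟨δ 0, hδ 0, fun a b hab => ?_⟩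
  let Good : ℕ → ℕ × (ℕ → X) → Prop := fun n p => 1 ≤ p.1 ∧ p.2 0 = a ∧ (∀ k, p.1 ≤ k → p.2 k = b) ∧
    ∀ k, dist (p.2 k) (p.2 (k+1)) < δ n
  have step : ∀ n (p : ℕ × (ℕ → X)), ∃ p' : ℕ × (ℕ → X), Good n p → Good (n+1) p' ∧
      ∃ N, 1 ≤ N ∧ p'.1 = p.1 * N ∧ ∀ k, dist (p.2 (k / N)) (p'.2 k) ≤ e n := by
    intro n p
    by_cases hp : Good n p
    · obtain ⟨g1, g2, g3, g4⟩ := hp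
      obtain ⟨N, g, k1, k2, k3, k4, k5⟩ := dd_step (hδ (n+1)) (he n).le (H₀ n) a b p.1 p.2 g2 g3
        (fun k => (g4 k).trans_le (min_le_left _ _))
      exact ⟨(p.1 * N, g), fun _ => ⟨⟨Nat.mul_pos g1 k1, k2, k3, k4⟩, N, k1, rfl, k5⟩⟩
    · exact ⟨p, fun h => absurd h hp⟩
  choose G hG using step
  let S : ℕ → ℕ × (ℕ → X) := fun n => Nat.rec (1, fun k => if k = 0 then a else b) G n
  have S0 : S 0 = (1, fun k => if k = 0 then a else b) := rfl
  have SS : ∀ n, S (n+1) = G n (S n) := fun n => rfl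
  have good : ∀ n, Good n (S n) := by
    intro n
    induction n with
    | zero =>
      rw [S0]
      refine ⟨le_rfl, by simp, ?_, ?_⟩
      · intro k hk
        have : k ≠ 0 := by dsimp at hk; omega
        simp [this]
      · intro k
        dsimp only
        split_ifs <;> simp_all [hδ 0]
    | succ n ih => rw [SS]; exact (hG n _ ih).1
  have hstep : ∀ n, ∃ N, 1 ≤ N ∧ (S (n+1)).1 = (S n).1 * N ∧
      ∀ k, dist ((S n).2 (k / N)) ((S (n+1)).2 k) ≤ e n := fun n => by
    rw [SS]; exact (hG n _ (good n)).2
  let F : ℕ → ℝ → X := fun n t => (S n).2 ⌊t * (S n).1⌋₊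
  have hF : ∀ t n, dist (F n t) (F (n+1) t) ≤ e n := by
    intro t n
    obtain ⟨N, hN, h1, h2⟩ := hstep n
    have : ⌊t * (S n).1⌋₊ = ⌊t * (S (n+1)).1⌋₊ / N := by
      rw [← Nat.floor_div_natCast, h1]
      congr 1
      have : (N:ℝ) ≠ 0 := by positivity
      push_cast
      field_simp
    simp only [F]
    rw [this]
    exact h2 _
  have hlim : ∀ t, ∃ l, Tendsto (fun n => F n t) atTop (nhds l) := fun t =>
    cauchySeq_tendsto_of_complete (cauchySeq_of_le_geometric_two (C := r/2) (hF t))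
  choose γ hγ using hlim
  have hd : ∀ t n, dist (F n t) (γ t) ≤ r / 2 / 2 ^ n := fun t n =>
    dist_le_of_le_geometric_two_of_tendsto (hF t) (hγ t) n
  have hF0 : ∀ n, F n 0 = a := fun n => by simp [F, (good n).2.1]
  have hF1 : ∀ n, F n 1 = b := fun n => by simp [F, (good n).2.2.1]
  refine ⟨γ, ?_, ?_, ?_, ?_⟩
  · rw [Metric.continuous_iff]
    intro t ε hε
    obtain ⟨n, hn⟩ : ∃ n, 2 * r / 2 ^ n < ε := by
      have : Tendsto (fun n : ℕ => 2 * r * (1/2 : ℝ) ^ n) atTop (nhds (2 * r * 0)) :=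
        (tendsto_pow_atTop_nhds_zero_of_lt_one (by norm_num) (by norm_num)).const_mul _
      rw [mul_zero] at this
      obtain ⟨n, hn⟩ := (this.eventually (gt_mem_nhds hε)).exists
      refine ⟨n, ?_⟩
      simpa [div_eq_mul_inv] using hn
    have hM : (0:ℝ) < (S n).1 := by exact_mod_cast (good n).1
    have aux : ∀ s t : ℝ, s ≤ t → t - s < 1 / (S n).1 → dist (F n s) (F n t) ≤ e n := by
      intro s t hst hlt
      have h1 : ⌊s * (S n).1⌋₊ ≤ ⌊t * (S n).1⌋₊ := Nat.floor_mono (by gcongr)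
      have h2 : ⌊t * (S n).1⌋₊ ≤ ⌊s * (S n).1⌋₊ + 1 := by
        rw [lt_div_iff₀ hM] at hlt
        by_cases h : 0 ≤ s * (S n).1
        · rw [← Nat.floor_add_one h]
          apply Nat.floor_mono
          linarith
        · have : ⌊t * (S n).1⌋₊ ≤ 1 := Nat.floor_le_of_le (by push_cast; linarith)
          omega
      simp only [F]
      rcases h1.eq_or_lt with h | h
      · rw [h, dist_self]; exact (he n).le
      · have : ⌊t * (S n).1⌋₊ = ⌊s * (S n).1⌋₊ + 1 := by omega
        rw [this]
        exact (((good n).2.2.2 _).le).trans (min_le_right _ _)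
    refine ⟨1 / (S n).1, by positivity, fun s hs => ?_⟩
    have h3 : dist (F n s) (F n t) ≤ e n := by
      rw [Real.dist_eq, abs_lt] at hs
      rcases le_total s t with h | h
      · exact aux s t h (by linarith)
      · rw [dist_comm]; exact aux t s h (by linarith)
    have h4 := hd s n
    have h5 := hd t n
    have h6 := dist_triangle4 (γ s) (F n s) (F n t) (γ t)
    rw [dist_comm (γ s) (F n s)] at h6
    have h7 : 0 < r / 2 ^ n := by positivity
    have h8 : e n = (r / 2 ^ n) / 4 := by simp only [e]; ring
    have h9 : r / 2 / 2 ^ n = (r / 2 ^ n) / 2 := by ring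
    have h10 : 2 * r / 2 ^ n = 2 * (r / 2 ^ n) := by ring
    linarith
  · refine tendsto_nhds_unique (hγ 0) ?_
    simp [hF0]
  · refine tendsto_nhds_unique (hγ 1) ?_
    simp [hF1]
  · intro t
    have h1 := hd t 0
    have h2 : dist a (F 0 t) ≤ r / 4 := by
      have hab' : dist a b ≤ r / 4 := by
        have : dist a b ≤ e 0 := hab.le.trans (min_le_right _ _)
        simp only [e] at this
        norm_num at this
        linarith
      simp only [F, S0]
      split_ifs
      · rw [dist_self]; positivity
      · exact hab'
    have := dist_triangle a (F 0 t) (γ t)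
    norm_num at h1
    linarith

lemma dd_floor {C : Set ℝ} (hC : IsClosed C) (h0 : Iic 0 ⊆ C) (t : ℝ) :
    ∃ s ∈ C, s ≤ t ∧ ∀ c ∈ C, c ≤ t → c ≤ s := by
  have hc : IsCompact (C ∩ Icc (min t 0) t) := isCompact_Icc.inter_left hC
  obtain ⟨s, hs, hs'⟩ := hc.exists_isGreatest
    ⟨min t 0, h0 (mem_Iic.2 (min_le_right _ _)), le_rfl, min_le_left _ _⟩
  refine ⟨s, hs.1, hs.2.2, fun c hcC hct => ?_⟩
  by_cases h : min t 0 ≤ c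
  · exact hs' ⟨hcC, h, hct⟩
  · exact (not_le.1 h).le.trans hs.2.1

lemma dd_ceil {C : Set ℝ} (hC : IsClosed C) (h0 : Ici 1 ⊆ C) (t : ℝ) :
    ∃ s ∈ C, t ≤ s ∧ ∀ c ∈ C, t ≤ c → s ≤ c := by
  have hc : IsCompact (C ∩ Icc t (max t 1)) := isCompact_Icc.inter_left hC
  obtain ⟨s, hs, hs'⟩ := hc.exists_isLeast
    ⟨max t 1, h0 (mem_Ici.2 (le_max_right _ _)), le_max_left _ _, le_rfl⟩
  refine ⟨s, hs.1, hs.2.1, fun c hcC hct => ?_⟩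
  by_cases h : c ≤ max t 1
  · exact hs' ⟨hcC, hct, h⟩
  · exact hs.2.2.trans (not_le.1 h).le

lemma dd_min (γ : ℝ → X) (hγ : Continuous γ) :
    ∃ C : Set ℝ, IsClosed C ∧ Iic 0 ⊆ C ∧ Ici 1 ⊆ C ∧
      (∀ a ∈ C, ∀ b ∈ C, a < b → (∀ c ∈ C, ¬ (a < c ∧ c < b)) → γ a = γ b) ∧
      (∀ s ∈ C, ∀ t ∈ C, 0 ≤ s → t ≤ 1 → s < t → γ s = γ t → ∀ c ∈ C, ¬ (s < c ∧ c < t)) := by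
  obtain ⟨C, hC⟩ := zorn_superset {C : Set ℝ | IsClosed C ∧ Iic 0 ⊆ C ∧ Ici 1 ⊆ C ∧
      (∀ a ∈ C, ∀ b ∈ C, a < b → (∀ c ∈ C, ¬ (a < c ∧ c < b)) → γ a = γ b)} (by
    intro c hc hchain
    rcases c.eq_empty_or_nonempty with rfl | hne
    · refine ⟨univ, ⟨isClosed_univ, subset_univ _, subset_univ _, ?_⟩, by simp⟩
      intro a _ b _ hab h
      obtain ⟨m, hm⟩ := exists_between hab
      exact absurd hm (h m (mem_univ _))
    · refine ⟨⋂₀ c, ⟨isClosed_sInter fun C hC => (hc hC).1,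
        subset_sInter fun C hC => (hc hC).2.1, subset_sInter fun C hC => (hc hC).2.2.1, ?_⟩,
        fun s hs => sInter_subset_of_mem hs⟩
      intro a ha b hb hab h
      by_contra hne'
      obtain ⟨U, W, hU, hW, haU, hbW, hUW⟩ := t2_separation hne'
      obtain ⟨η₁, h₁, hη₁⟩ := Metric.isOpen_iff.1 (hU.preimage hγ) a haU
      obtain ⟨η₂, h₂, hη₂⟩ := Metric.isOpen_iff.1 (hW.preimage hγ) b hbW
      obtain ⟨η, hη0, hη⟩ : ∃ η > 0, η < η₁ ∧ η < η₂ ∧ a + η < b - η := by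
        refine ⟨min (min η₁ η₂) (b - a) / 3, ?_, ?_⟩
        · have : 0 < b - a := by linarith
          positivity
        · have e1 := min_le_left (min η₁ η₂) (b - a)
          have e2 := min_le_right (min η₁ η₂) (b - a)
          have e3 := min_le_left η₁ η₂
          have e4 := min_le_right η₁ η₂
          refine ⟨?_, ?_, ?_⟩ <;> linarith
      have : Nonempty c := hne.to_subtype
      obtain ⟨⟨C, hCc⟩, hC⟩ := (isCompact_Icc (a := a + η) (b := b - η)).elim_directed_family_closed
        (fun i : c => (i : Set ℝ)) (fun i => (hc i.2).1) (by
          rw [← sInter_eq_iInter]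
          ext z
          simp only [mem_inter_iff, mem_empty_iff_false, iff_false, not_and]
          intro hz hz'
          exact h z hz' ⟨by linarith [hz.1], by linarith [hz.2]⟩) (by
          intro i j
          rcases hchain.total i.2 j.2 with h | h
          · exact ⟨i, subset_rfl, h⟩
          · exact ⟨j, h, subset_rfl⟩)
      obtain ⟨k1, k2, k3, k4⟩ := hc hCc
      have hCn : ∀ z ∈ C, ¬ (a + η ≤ z ∧ z ≤ b - η) := fun z hz hz' => by
        have : z ∈ Icc (a+η) (b-η) ∩ C := ⟨hz', hz⟩
        dsimp only at hC
        rw [hC] at this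
        exact this
      obtain ⟨s, s1, s2, s3⟩ := dd_floor k1 k2 (a + η)
      obtain ⟨t, t1, t2, t3⟩ := dd_ceil k1 k3 (b - η)
      have hs := s3 a (ha C hCc) (by linarith)
      have ht := t3 b (hb C hCc) (by linarith)
      have e := k4 s s1 t t1 (by linarith) (by
        intro z hz hz'
        apply hCn z hz
        constructor
        · by_contra hh
          have := s3 z hz (by linarith); linarith
        · by_contra hh
          have := t3 z hz (by linarith); linarith)
      have u1 : γ s ∈ U := hη₁ (by rw [mem_ball, Real.dist_eq, abs_lt]; constructor <;> linarith)
      have u2 : γ t ∈ W := hη₂ (by rw [mem_ball, Real.dist_eq, abs_lt]; constructor <;> linarith)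
      exact disjoint_left.1 hUW u1 (e ▸ u2))
  obtain ⟨k1, k2, k3, k4⟩ := hC.prop
  refine ⟨C, k1, k2, k3, k4, ?_⟩
  intro s hs t ht hs0 ht1 hst e c hc hcc
  have : C ⊆ C \ Ioo s t := by
    apply hC.le_of_le _ sdiff_subset
    refine ⟨k1.sdiff isOpen_Ioo, ?_, ?_, ?_⟩
    · intro z hz
      exact ⟨k2 hz, fun h => by have := h.1; have : z ≤ 0 := hz; linarith⟩
    · intro z hz
      exact ⟨k3 hz, fun h => by have := h.2; have : 1 ≤ z := hz; linarith⟩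
    · intro a ha b hb hab h
      have sm : s ∈ C \ Ioo s t := ⟨hs, fun h => lt_irrefl _ h.1⟩
      have tm : t ∈ C \ Ioo s t := ⟨ht, fun h => lt_irrefl _ h.2⟩
      by_cases h1 : ∃ z ∈ C, a < z ∧ z < b
      · obtain ⟨z, hz, hz'⟩ := h1
        have hzst : s < z ∧ z < t := by
          by_contra hh
          exact h z ⟨hz, hh⟩ hz'
        have ha' : a = s := by
          rcases lt_trichotomy a s with q | q | q
          · exact absurd ⟨q, hzst.1.trans hz'.2⟩ (h s sm)
          · exact q
          · exact absurd ⟨q, hz'.1.trans hzst.2⟩ ha.2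
        have hb' : b = t := by
          rcases lt_trichotomy b t with q | q | q
          · exact absurd ⟨hzst.1.trans hz'.2, q⟩ hb.2
          · exact q
          · exact absurd ⟨hz'.1.trans hzst.2, q⟩ (h t tm)
        rw [ha', hb', e]
      · push Not at h1
        exact k4 a ha.1 b hb.1 hab (fun z hz hz' => absurd hz'.2 (not_lt.2 (h1 z hz hz'.1)))
  exact (this hc).2 hcc

lemma dd_mono (γ : ℝ → X) (hγ : Continuous γ) :
    ∃ g : ℝ → X, Continuous g ∧ g 0 = γ 0 ∧ g 1 = γ 1 ∧ (∀ t ∈ Icc (0:ℝ) 1, ∃ s ∈ Icc (0:ℝ) 1, g t = γ s) ∧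
      ∀ s m t, 0 ≤ s → s ≤ m → m ≤ t → t ≤ 1 → g s = g t → g m = g s := by
  obtain ⟨C, k1, k2, k3, k4, k5⟩ := dd_min γ hγ
  choose ρ r1 r2 r3 using fun t => dd_floor k1 k2 t
  have rC : ∀ t ∈ C, ρ t = t := fun t ht => le_antisymm (r2 t) (r3 t t ht le_rfl)
  have rm : ∀ s t, s ≤ t → ρ s ≤ ρ t := fun s t h => r3 t _ (r1 s) ((r2 s).trans h)
  have h0 : ρ 0 = 0 := rC 0 (k2 (le_refl (0:ℝ)))
  have h1 : ρ 1 = 1 := rC 1 (k3 (le_refl (1:ℝ)))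
  refine ⟨fun t => γ (ρ t), ?_, by simp [h0], by simp [h1], ?_, ?_⟩
  · rw [Metric.continuous_iff]
    intro t ε hε
    by_cases ht : t ∈ C
    · obtain ⟨δ₀, hδ₀, H⟩ := Metric.continuous_iff.1 hγ t ε hε
      rw [rC t ht]
      by_cases hl : ∃ c ∈ C, t - δ₀ < c ∧ c < t
      · obtain ⟨c, hc, c1, c2⟩ := hl
        refine ⟨t - c, by linarith, fun s hs => H _ ?_⟩
        rw [Real.dist_eq, abs_lt] at hs ⊢
        have := r3 s c hc (by linarith)
        have := r2 s
        constructor <;> linarith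
      · push Not at hl
        refine ⟨δ₀, hδ₀, fun s hs => ?_⟩
        rw [Real.dist_eq, abs_lt] at hs
        rcases lt_or_ge s t with hst | hst
        · have := k4 (ρ s) (r1 s) t ht ((r2 s).trans_lt hst) (by
            rintro z hz ⟨z1, z2⟩
            by_cases hzs : z ≤ s
            · have := r3 s z hz hzs; linarith
            · have := hl z hz (by linarith); linarith)
          rw [this, dist_self]; exact hε
        · apply H
          rw [Real.dist_eq, abs_lt]
          have := r3 s t ht hst
          have := r2 s
          constructor <;> linarith
    · obtain ⟨δ, hδ, H⟩ := Metric.isOpen_iff.1 k1.isOpen_compl t ht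
      have H' : ∀ z ∈ C, ¬ (t - δ < z ∧ z < t + δ) := fun z hz hz' => H (by
        rw [mem_ball, Real.dist_eq, abs_lt]; constructor <;> linarith) hz
      refine ⟨δ, hδ, fun s hs => ?_⟩
      rw [Real.dist_eq, abs_lt] at hs
      have : ρ s = ρ t := by
        apply le_antisymm
        · apply r3 t _ (r1 s)
          by_contra hh
          exact H' _ (r1 s) ⟨by linarith, by linarith [r2 s]⟩
        · apply r3 s _ (r1 t)
          by_contra hh
          exact H' _ (r1 t) ⟨by linarith, by linarith [r2 t]⟩
      rw [this, dist_self]; exact hε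
  · intro t ht
    exact ⟨ρ t, ⟨h0 ▸ rm 0 t ht.1, h1 ▸ rm t 1 ht.2⟩, rfl⟩
  · intro s m t hs hsm hmt ht e
    dsimp only at e ⊢
    have a1 := rm _ _ hsm
    have a2 := rm _ _ hmt
    rcases a1.eq_or_lt with q | q
    · rw [q]
    rcases a2.eq_or_lt with q' | q'
    · rw [q', e]
    exact absurd ⟨q, q'⟩ (k5 _ (r1 s) _ (r1 t) (h0 ▸ rm 0 s hs) (h1 ▸ rm t 1 ht) (q.trans q') e _ (r1 m))

lemma dd_phi (g : ℝ → X) (hg : Continuous g)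
    (hm : ∀ s m t, 0 ≤ s → s ≤ m → m ≤ t → t ≤ 1 → g s = g t → g m = g s) :
    ∃ φ : ℝ → ℝ, Continuous φ ∧ 
      (∀ s t, 0 ≤ s → s ≤ t → t ≤ 1 → g s = g t → φ s = φ t) ∧
      (∀ s t, 0 ≤ s → s ≤ t → t ≤ 1 → g s ≠ g t → φ s < φ t) := by
  let ψ : ℝ × ℝ → ℝ := fun p =>
    sSup ((fun s : ℝ => dist (g p.2) (g (max p.2 (min s p.1)))) '' Icc (0:ℝ) 1)
  have hψ : Continuous ψ := by
    apply IsCompact.continuous_sSup (f := fun (p : ℝ × ℝ) (s : ℝ) =>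
      dist (g p.2) (g (max p.2 (min s p.1)))) isCompact_Icc
    simp only [Function.HasUncurry.uncurry, id]
    fun_prop
  have hbdd : ∀ p : ℝ × ℝ, BddAbove ((fun s : ℝ => dist (g p.2) (g (max p.2 (min s p.1)))) '' Icc (0:ℝ) 1) := by
    intro p
    apply (isCompact_Icc.image _).bddAbove
    fun_prop
  have hψ' : ∀ t, Continuous fun q => ψ (t, q) := fun t => by fun_prop
  have mono : ∀ s t q, 0 ≤ s → s ≤ t → ψ (s, q) ≤ ψ (t, q) := by
    intro s t q hs hst
    apply csSup_le_csSup (hbdd _) ((nonempty_Icc.2 zero_le_one).image _)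
    rintro _ ⟨z, hz, rfl⟩
    refine ⟨min z s, ⟨le_min hz.1 hs, (min_le_left _ _).trans hz.2⟩, ?_⟩
    dsimp only
    rw [min_assoc, min_eq_left hst]
  refine ⟨fun t => ∫ q in (0:ℝ)..1, ψ (t, q), ?_, ?_, ?_⟩
  · exact intervalIntegral.continuous_parametric_intervalIntegral_of_continuous' (f := fun t q => ψ (t, q)) (by simpa [Function.uncurry_def] using hψ) 0 1
  · intro s t hs hst ht e
    apply intervalIntegral.integral_congr
    intro q hq
    simp only [ψ]
    congr 1
    apply image_congr
    intro z hz
    by_cases h1 : min z t ≤ s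
    · have : min z s = min z t := by
        apply le_antisymm
        · exact min_le_min_left _ hst
        · exact le_min (min_le_left _ _) h1
      rw [this]
    · push Not at h1
      have hzs : s < z := h1.trans_le (min_le_left _ _)
      have e1 : g (min z t) = g s := hm s _ t hs h1.le (min_le_right _ _) ht e
      rw [min_eq_right hzs.le]
      rcases le_total q s with h | h
      · rw [max_eq_right h, max_eq_right (h.trans h1.le), e1]
      · rw [max_eq_left h]
        rcases le_total q (min z t) with h' | h'
        · rw [max_eq_right h', e1]
          rw [hm s q t hs h (h'.trans (min_le_right _ _)) ht e, dist_self]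
        · rw [max_eq_left h']
  · intro s t hs hst ht ne
    have hlt : s < t := lt_of_le_of_ne hst (fun h => ne (by rw [h]))
    obtain ⟨q, hq1, hq2, hq3⟩ : ∃ q, s < q ∧ q < t ∧ g q ≠ g t := by
      have h1 : ∀ᶠ q in nhds s, g q ≠ g t := hg.continuousAt.eventually_ne ne
      have h2 : ∀ᶠ q in nhdsWithin s (Ioi s), g q ≠ g t ∧ q ∈ Ioo s t :=
        (h1.filter_mono nhdsWithin_le_nhds).and (Ioo_mem_nhdsGT hlt)
      obtain ⟨q, h3, h4⟩ := h2.exists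
      exact ⟨q, h4.1, h4.2, h3⟩
    apply intervalIntegral.integral_lt_integral_of_continuousOn_of_le_of_exists_lt zero_lt_one
      (hψ' s).continuousOn (hψ' t).continuousOn (fun q _ => mono s t q hs hst)
    refine ⟨q, ⟨by linarith, by linarith⟩, ?_⟩
    have e1 : ψ (s, q) ≤ 0 := by
      apply csSup_le ((nonempty_Icc.2 zero_le_one).image _)
      rintro _ ⟨z, hz, rfl⟩
      dsimp only
      rw [max_eq_left ((min_le_right _ _).trans hq1.le), dist_self]
    have e2 : dist (g q) (g t) ≤ ψ (t, q) := by
      apply le_csSup (hbdd _)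
      refine ⟨1, ⟨zero_le_one, le_rfl⟩, ?_⟩
      dsimp only
      rw [min_eq_right ht, max_eq_right hq2.le]
    exact e1.trans_lt ((dist_pos.2 hq3).trans_le e2)

lemma dd_arc0 (g : ℝ → X) (hg : Continuous g) (hne : g 0 ≠ g 1)
    (hm : ∀ s m t, 0 ≤ s → s ≤ m → m ≤ t → t ≤ 1 → g s = g t → g m = g s) :
    ∃ σ : unitInterval → X, Continuous σ ∧ Function.Injective σ ∧ σ 0 = g 0 ∧ σ 1 = g 1 ∧
      ∀ c, ∃ t ∈ Icc (0:ℝ) 1, σ c = g t := by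
  obtain ⟨φ, h1, h2, h3⟩ := dd_phi g hg hm
  have hmono : ∀ s t, 0 ≤ s → s ≤ t → t ≤ 1 → φ s ≤ φ t := fun s t a b c => by
    by_cases h : g s = g t
    · exact (h2 s t a b c h).le
    · exact (h3 s t a b c h).le
  have hiff : ∀ s ∈ Icc (0:ℝ) 1, ∀ t ∈ Icc (0:ℝ) 1, φ s = φ t ↔ g s = g t := by
    intro s hs t ht
    rcases le_total s t with h | h
    · refine ⟨fun e => ?_, h2 s t hs.1 h ht.2⟩
      by_contra hh
      exact (h3 s t hs.1 h ht.2 hh).ne e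
    · refine ⟨fun e => ?_, fun e => (h2 t s ht.1 h hs.2 e.symm).symm⟩
      by_contra hh
      exact (h3 t s ht.1 h hs.2 (Ne.symm hh)).ne e.symm
  have hL : φ 0 < φ 1 := h3 0 1 le_rfl zero_le_one le_rfl hne
  have hL' : 0 < φ 1 - φ 0 := by linarith
  let Φ : unitInterval → unitInterval := fun t => ⟨(φ t - φ 0) / (φ 1 - φ 0), by
    have a1 := hmono 0 t le_rfl t.2.1 t.2.2
    have a2 := hmono t 1 t.2.1 t.2.2 le_rfl
    constructor
    · apply div_nonneg <;> linarith
    · rw [div_le_one hL']; linarith⟩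
  have hΦ : Continuous Φ := by
    apply Continuous.subtype_mk
    fun_prop
  have hΦs : Function.Surjective Φ := by
    intro c
    have : φ 0 + c * (φ 1 - φ 0) ∈ φ '' Icc 0 1 := by
      apply intermediate_value_Icc zero_le_one h1.continuousOn
      have := c.2.1
      have := c.2.2
      constructor <;> nlinarith
    obtain ⟨t, ht, e⟩ := this
    refine ⟨⟨t, ht⟩, Subtype.ext ?_⟩
    simp only [Φ, e]
    field_simp
    ring
  have hΦi : ∀ s t, Φ s = Φ t ↔ g s = g t := by
    intro s t
    rw [← hiff s s.2 t t.2, Subtype.ext_iff]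
    simp only [Φ]
    rw [div_left_inj' hL'.ne']
    simp
  choose inv hinv using hΦs
  have key : ∀ t, g (inv (Φ t)) = g t := fun t => (hΦi _ _).1 (hinv _)
  have hq := hΦ.isClosedMap.isQuotientMap hΦ (fun c => ⟨inv c, hinv c⟩)
  have e0 : Φ 0 = 0 := Subtype.ext (by simp [Φ])
  have e1 : Φ 1 = 1 := Subtype.ext (by simp [Φ, hL'.ne'])
  refine ⟨fun c => g (inv c), ?_, ?_, ?_, ?_, fun c => ⟨inv c, (inv c).2, rfl⟩⟩
  · rw [hq.continuous_iff]
    have : (fun c => g (inv c)) ∘ Φ = fun t : unitInterval => g t := funext key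
    rw [this]
    fun_prop
  · intro a b hab
    have := (hΦi _ _).2 hab
    rwa [hinv, hinv] at this
  · have := key 0
    rw [e0] at this
    simpa using this
  · have := key 1
    rw [e1] at this
    simpa using this

lemma dd_circle (hX : ∀ s : Set X, ¬ Nonempty (s ≃ₜ (Metric.sphere (0 : ℂ) 1 : Set ℂ)))
    (α β : ℝ → X) (hα : Continuous α) (hβ : Continuous β) (iα : InjOn α (Icc 0 1))
    (iβ : InjOn β (Icc 0 1)) (h0 : α 0 = β 0) (h1 : α 1 = β 1)
    (hd : ∀ s ∈ Ioo (0:ℝ) 1, ∀ t ∈ Icc (0:ℝ) 1, α s ≠ β t) : False := by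
  let f : ℝ → X := fun t => if t ≤ 1 then α t else β (2 - t)
  have hf : Continuous f := by
    apply Continuous.if_le hα (by fun_prop) continuous_id continuous_const
    intro t ht
    simp only [id] at ht
    subst ht
    norm_num [h1]
  have f0 : f 0 = f 2 := by simp [f, h0]
  have fi : InjOn f (Ico 0 2) := by
    have aux : ∀ s ∈ Ico (0:ℝ) 2, ∀ t ∈ Ico (0:ℝ) 2, s ≤ 1 → ¬ t ≤ 1 → α s ≠ β (2 - t) := by
      intro s hs t ht h h' e
      push Not at h'
      have ht2 : 2 - t ∈ Icc (0:ℝ) 1 := ⟨by linarith [ht.2], by linarith⟩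
      rcases hs.1.eq_or_lt with q | q
      · rw [← q, h0] at e
        have := iβ ⟨le_rfl, zero_le_one⟩ ht2 e
        linarith [ht.2]
      · rcases h.eq_or_lt with q' | q'
        · rw [q', h1] at e
          have := iβ ⟨zero_le_one, le_rfl⟩ ht2 e
          linarith
        · exact hd s ⟨q, q'⟩ _ ht2 e
    intro s hs t ht e
    simp only [f] at e
    split_ifs at e with a b b
    · exact iα ⟨hs.1, a⟩ ⟨ht.1, b⟩ e
    · exact absurd e (aux s hs t ht a b)
    · exact absurd e.symm (aux t ht s hs b a)
    · push Not at a b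
      have := iβ ⟨by linarith [hs.2], by linarith⟩ ⟨by linarith [ht.2], by linarith⟩ e
      linarith
  have : Fact ((0:ℝ) < 2) := ⟨two_pos⟩
  let F : AddCircle (2:ℝ) → X := AddCircle.liftIco 2 0 f
  have hF : Continuous F := AddCircle.liftIco_zero_continuous f0 hf.continuousOn
  have iF : Function.Injective F := by
    intro a b hab
    have ha : ∀ a : AddCircle (2:ℝ), ∃ z ∈ Ico (0:ℝ) 2, (z : AddCircle (2:ℝ)) = a := by
      intro a
      have := (AddCircle.equivIco (2:ℝ) 0 a).2
      exact ⟨_, ⟨this.1, by linarith [this.2]⟩, (AddCircle.equivIco (2:ℝ) 0).symm_apply_apply a⟩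
    obtain ⟨s, hs, rfl⟩ := ha a
    obtain ⟨t, ht, rfl⟩ := ha b
    simp only [F] at hab
    rw [AddCircle.liftIco_zero_coe_apply hs, AddCircle.liftIco_zero_coe_apply ht] at hab
    rw [fi hs ht hab]
  have hem := (hF.isClosedEmbedding iF).toIsEmbedding
  have e1 : Circle ≃ₜ (Metric.sphere (0 : ℂ) 1 : Set ℂ) := Homeomorph.refl _
  exact hX _ ⟨hem.toHomeomorph.symm.trans ((AddCircle.homeomorphCircle two_ne_zero).trans e1)⟩

lemma dd_ext {γ : unitInterval → X} (hγ : Continuous γ) (iγ : Function.Injective γ) :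
    ∃ G : ℝ → X, Continuous G ∧ InjOn G (Icc 0 1) ∧ ∀ t : unitInterval, G t = γ t := by
  refine ⟨IccExtend zero_le_one γ, hγ.Icc_extend', ?_, fun t => IccExtend_val _ _ _⟩
  intro s hs t ht e
  rw [IccExtend_of_mem _ _ hs, IccExtend_of_mem _ _ ht] at e
  exact congrArg Subtype.val (iγ e)

lemma dd_unique (hX : ∀ s : Set X, ¬ Nonempty (s ≃ₜ (Metric.sphere (0 : ℂ) 1 : Set ℂ)))
    {x y : X} {A B : Set X} (hA : IsArc A x y) (hB : IsArc B x y) : A ⊆ B := by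
  obtain ⟨α, cα, iα, a0, a1, rfl⟩ := hA
  obtain ⟨β, cβ, iβ, b0, b1, rfl⟩ := hB
  obtain ⟨f, cf, jf, ef⟩ := dd_ext cα iα
  obtain ⟨g, cg, jg, eg⟩ := dd_ext cβ iβ
  rintro _ ⟨t₀, rfl⟩
  by_contra hp
  have hBc : IsClosed (range β) := (isCompact_range cβ).isClosed
  have e0 := ef 0
  have e1 := ef 1
  simp only [Set.Icc.coe_zero, Set.Icc.coe_one] at e0 e1
  have f0 : f 0 ∈ range β := ⟨0, by rw [e0, a0, b0]⟩
  have f1 : f 1 ∈ range β := ⟨1, by rw [e1, a1, b1]⟩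
  have hK := hBc.preimage cf
  obtain ⟨s, hs, hs'⟩ := ((isCompact_Icc (a := (0:ℝ)) (b := t₀)).inter_left hK).exists_isGreatest
    ⟨0, f0, le_rfl, t₀.2.1⟩
  obtain ⟨t, ht, ht'⟩ := ((isCompact_Icc (a := (t₀:ℝ)) (b := 1)).inter_left hK).exists_isLeast
    ⟨1, f1, t₀.2.2, le_rfl⟩
  have hn : f t₀ ∉ range β := by rwa [ef]
  have st : s < t := by
    refine lt_of_le_of_ne (hs.2.2.trans ht.2.1) (fun e => hn ?_)
    have : (t₀ : ℝ) = s := le_antisymm (e ▸ ht.2.1) hs.2.2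
    rw [this]; exact hs.1
  obtain ⟨s', es⟩ := hs.1
  obtain ⟨t', et⟩ := ht.1
  have hsI : s ∈ Icc (0:ℝ) 1 := ⟨hs.2.1, hs.2.2.trans t₀.2.2⟩
  have htI : t ∈ Icc (0:ℝ) 1 := ⟨t₀.2.1.trans ht.2.1, ht.2.2⟩
  have hst' : (s' : ℝ) ≠ t' := by
    intro e
    have : s' = t' := Subtype.ext e
    rw [this, et] at es
    exact st.ne (jf hsI htI es.symm)
  have conv : ∀ a ∈ Icc (0:ℝ) 1, ∀ b ∈ Icc (0:ℝ) 1, ∀ z ∈ Icc (0:ℝ) 1, a + z * (b - a) ∈ Icc (0:ℝ) 1 := by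
    intro a ha b hb z hz
    constructor
    · nlinarith [mul_nonneg hz.1 hb.1, mul_nonneg (sub_nonneg.2 hz.2) ha.1]
    · nlinarith [mul_nonneg hz.1 (sub_nonneg.2 hb.2), mul_nonneg (sub_nonneg.2 hz.2) (sub_nonneg.2 ha.2)]
  refine dd_circle hX (fun z => f (s + z * (t - s))) (fun z => g (s' + z * (t' - s'))) (by fun_prop)
    (by fun_prop) ?_ ?_ ?_ ?_ ?_
  · intro z hz w hw e
    have := jf (conv s hsI t htI z hz) (conv s hsI t htI w hw) e
    exact mul_right_cancel₀ (sub_pos.2 st).ne' (by linarith : z * (t - s) = w * (t - s))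
  · intro z hz w hw e
    have := jg (conv s' s'.2 t' t'.2 z hz) (conv s' s'.2 t' t'.2 w hw) e
    exact mul_right_cancel₀ (sub_ne_zero.2 hst'.symm)
      (by linarith : z * ((t':ℝ) - s') = w * (t' - s'))
  · simp [eg, es]
  · simp [eg, et]
  · intro z hz w hw e
    have hm : f (s + z * (t - s)) ∈ range β := by
      rw [e]
      exact ⟨⟨_, conv s' s'.2 t' t'.2 w hw⟩, (eg _).symm⟩
    have q1 : 0 < z * (t - s) := mul_pos hz.1 (sub_pos.2 st)
    have q2 : z * (t - s) < t - s := by nlinarith [mul_pos (sub_pos.2 hz.2) (sub_pos.2 st)]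
    rcases le_total (s + z * (t - s)) t₀ with h | h
    · have := hs' ⟨hm, by linarith [hsI.1], h⟩
      linarith
    · have := ht' ⟨hm, h, by linarith [htI.2]⟩
      linarith

lemma dd_joined_arc {S : Set X} {x y : X} (hxy : x ≠ y) (h : JoinedIn S x y) :
    ∃ A, IsArc A x y ∧ A ⊆ S := by
  obtain ⟨p, hp⟩ := h
  have hc : Continuous (p.extend) := p.continuous_extend
  obtain ⟨g, cg, g0, g1, g2, g3⟩ := dd_mono p.extend hc
  rw [p.extend_zero] at g0
  rw [p.extend_one] at g1
  obtain ⟨σ, s1, s2, s3, s4, s5⟩ := dd_arc0 g cg (by rwa [g0, g1]) g3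
  refine ⟨range σ, ⟨σ, s1, s2, s3.trans g0, s4.trans g1, rfl⟩, ?_⟩
  rintro _ ⟨c, rfl⟩
  obtain ⟨t, ht, e⟩ := s5 c
  obtain ⟨s, hs, e'⟩ := g2 t ht
  rw [e, e', p.extend_apply hs]
  exact hp _

lemma dd_joinedIn [CompactSpace X] [LocallyConnectedSpace X] {r : ℝ} (hr : 0 < r) :
    ∃ δ > 0, ∀ a b : X, dist a b < δ → JoinedIn (closedBall a r) a b := by
  obtain ⟨δ, hδ, H⟩ := dd_path (X := X) hr
  refine ⟨δ, hδ, fun a b hab => ?_⟩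
  obtain ⟨γ, h1, h2, h3, h4⟩ := H a b hab
  refine ⟨⟨⟨fun t => γ t, by fun_prop⟩, by simp [h2], by simp [h3]⟩, fun t => ?_⟩
  rw [mem_closedBall, dist_comm]
  exact h4 t

lemma dd_joined [CompactSpace X] [LocallyConnectedSpace X] [ConnectedSpace X] (x y : X) :
    JoinedIn univ x y := by
  obtain ⟨δ, hδ, H⟩ := dd_joinedIn (X := X) one_pos
  rw [joinedIn_univ]
  refine (isPreconnected_univ (α := X)).induction₂' Joined ?_ ?_ (mem_univ x) (mem_univ y)
  · intro p _
    filter_upwards [nhdsWithin_le_nhds (ball_mem_nhds p hδ)] with q hq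
    have := (H p q (by rwa [dist_comm])).joined
    exact ⟨this, this.symm⟩
  · intro a b c _ _ _ h1 h2
    exact h1.trans h2
end

theorem stmt11 {X : Type*} [MetricSpace X] (hX : IsDendrite X)
    (x y : X) (hxy : x ≠ y) :
    ∃ ε : ℝ, 0 < ε ∧ ∃ J : Set X, (∃ a b : X, a ≠ b ∧ IsArc J a b) ∧
      (∀ A : Set X, IsArc A x y → J ⊆ A) ∧
      ∀ u ∈ Metric.ball x ε, ∀ v ∈ Metric.ball y ε,
        ∀ B : Set X, IsArc B u v → J ⊆ B := by
  obtain ⟨i1, i2, i3, hS⟩ := hX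
  obtain ⟨A, hA, -⟩ := dd_joined_arc hxy (dd_joined x y)
  have hA' := hA
  obtain ⟨γ, cγ, iγ, a0, a1, rfl⟩ := hA'
  let θ : unitInterval → unitInterval := fun t => ⟨(1 + t) / 3, by
    constructor
    · linarith [t.2.1]
    · linarith [t.2.2]⟩
  have cθ : Continuous θ := by
    apply Continuous.subtype_mk
    fun_prop
  have iθ : Function.Injective θ := by
    intro s t e
    have e' := congrArg Subtype.val e
    simp only [θ] at e'
    exact Subtype.ext (by linarith)
  have hJc : IsOpen (range (γ ∘ θ))ᶜ := (isCompact_range (cγ.comp cθ)).isClosed.isOpen_compl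
  have hx : x ∈ (range (γ ∘ θ))ᶜ := by
    rintro ⟨t, ht⟩
    have e' := congrArg Subtype.val (iγ (ht.trans a0.symm))
    simp only [θ, Set.Icc.coe_zero] at e'
    linarith [t.2.1]
  have hy : y ∈ (range (γ ∘ θ))ᶜ := by
    rintro ⟨t, ht⟩
    have e' := congrArg Subtype.val (iγ (ht.trans a1.symm))
    simp only [θ, Set.Icc.coe_one] at e'
    linarith [t.2.2]
  obtain ⟨r₁, hr₁, H₁⟩ := Metric.nhds_basis_closedBall.mem_iff.1 (hJc.mem_nhds hx)
  obtain ⟨r₂, hr₂, H₂⟩ := Metric.nhds_basis_closedBall.mem_iff.1 (hJc.mem_nhds hy)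
  obtain ⟨δ₁, hδ₁, D₁⟩ := dd_joinedIn (X := X) hr₁
  obtain ⟨δ₂, hδ₂, D₂⟩ := dd_joinedIn (X := X) hr₂
  refine ⟨min δ₁ δ₂, lt_min hδ₁ hδ₂, range (γ ∘ θ), ⟨_, _, ?_, γ ∘ θ, cγ.comp cθ, iγ.comp iθ,
    rfl, rfl, rfl⟩, ?_, ?_⟩
  · exact fun e => zero_ne_one ((iγ.comp iθ) e)
  · intro B hB
    exact (range_comp_subset_range _ _).trans (dd_unique hS hA hB)
  · intro u hu v hv B hB p hp
    by_contra hpB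
    have j1 : JoinedIn {p}ᶜ x u := by
      refine (D₁ x u ?_).mono fun z hz hzp => H₁ hz ?_
      · rw [dist_comm]; exact (mem_ball.1 hu).trans_le (min_le_left _ _)
      · rw [mem_singleton_iff.1 hzp]; exact hp
    have j2 : JoinedIn {p}ᶜ y v := by
      refine (D₂ y v ?_).mono fun z hz hzp => H₂ hz ?_
      · rw [dist_comm]; exact (mem_ball.1 hv).trans_le (min_le_right _ _)
      · rw [mem_singleton_iff.1 hzp]; exact hp
    have j3 : JoinedIn {p}ᶜ u v := by
      obtain ⟨b, cb, ib, b0, b1, rfl⟩ := hB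
      exact ⟨⟨⟨b, cb⟩, b0, b1⟩, fun t ht => hpB ⟨t, ht⟩⟩
    obtain ⟨A', hA', hA'p⟩ := dd_joined_arc hxy ((j1.trans j3).trans j2.symm)
    exact hA'p (dd_unique hS hA hA' (range_comp_subset_range _ _ hp)) rfl
end

section
/- Let X be a dendrite, F a nonempty closed subset of X, and a ∈ F. Then the convex hull [F] (the intersection of all subdendrites of X containing F) equals ⋃_{z ∈ F} [a, z]. -/
open Set Metric Filter

/-- `A` is either the degenerate arc `{x}` (when `x = y`) or an arc from `x` to `y`. -/
def IsArcOrPt {X : Type*} [TopologicalSpace X] (A : Set X) (x y : X) : Prop :=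
  (x = y ∧ A = {x}) ∨ IsArc A x y

/-- The convex hull of a set `F` in a dendrite: the intersection of all
subdendrites (i.e. subcontinua) of `X` containing `F`. -/
def dendriteHull {X : Type*} [TopologicalSpace X] (F : Set X) : Set X :=
  ⋂₀ {D : Set X | F ⊆ D ∧ IsClosed D ∧ IsConnected D}

/-- `x` is an endpoint of the subdendrite `D`: removing it leaves `D` connected,
i.e. `ord(x, D) = 1`. -/
def IsEndpointOf {X : Type*} [TopologicalSpace X] (D : Set X) (x : X) : Prop :=
  x ∈ D ∧ IsConnected (D \ {x})


open Topology

inductive ChainPath {X E : Type*} [MetricSpace X] [NormedAddCommGroup E] [NormedSpace ℝ E]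
    (e : X → E) (ε : ℝ) : (x y : X) → Path (e x) (e y) → Prop
  | seg (x y : X) (W : Set X) (hW : IsPreconnected W) (ho : IsOpen W) (hx : x ∈ W) (hy : y ∈ W)
      (hd : ∀ u ∈ W, ∀ v ∈ W, dist u v ≤ ε) (p : Path (e x) (e y))
      (hp : ∀ t, dist (p t) (e x) ≤ ε) : ChainPath e ε x y p
  | trans (x y z : X) (p : Path (e x) (e y)) (q : Path (e y) (e z)) :
      ChainPath e ε x y p → ChainPath e ε y z q → ChainPath e ε x z (p.trans q)

section
variable {X E : Type*} [MetricSpace X] [NormedAddCommGroup E] [NormedSpace ℝ E]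

theorem exists_segPath {e : X → E} (he : Isometry e) {ε : ℝ} {x y : X}
    (h : dist x y ≤ ε) : ∃ p : Path (e x) (e y), ∀ t, dist (p t) (e x) ≤ ε := by
  have h0 : 0 ≤ ε := dist_nonneg.trans h
  have hc : IsPathConnected (closedBall (e x) ε) :=
    (convex_closedBall (e x) ε).isPathConnected ⟨e x, mem_closedBall_self h0⟩
  have hj := hc.joinedIn (e x) (mem_closedBall_self h0) (e y)
    (by rw [mem_closedBall, he.dist_eq, dist_comm]; exact h)
  exact ⟨hj.somePath, fun t => hj.somePath_mem t⟩

theorem trans_dist_le {E : Type*} [MetricSpace E] {a b c : E} {C : ℝ} (p p' : Path a b)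
    (q q' : Path b c)
    (hp : ∀ t, dist (p t) (p' t) ≤ C) (hq : ∀ t, dist (q t) (q' t) ≤ C) (t : unitInterval) :
    dist (p.trans q t) (p'.trans q' t) ≤ C := by
  rw [Path.trans_apply, Path.trans_apply]
  split_ifs with h
  · exact hp _
  · exact hq _

theorem exists_chainPath [LocallyConnectedSpace X] {e : X → E} (he : Isometry e) {ε : ℝ}
    (hε : 0 < ε) {W : Set X} (hW : IsPreconnected W) (ho : IsOpen W) {x y : X} (hx : x ∈ W)
    (hy : y ∈ W) :
    ∃ p, ChainPath e ε x y p ∧ ∀ t, ∃ w ∈ W, dist (p t) (e w) ≤ ε := by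
  refine hW.induction₂' (fun x y => ∃ p, ChainPath e ε x y p ∧
    ∀ t, ∃ w ∈ W, dist (p t) (e w) ≤ ε) ?_ ?_ hx hy
  · intro x hx
    obtain ⟨V, hVs, hVo, hxV, hVc⟩ := locallyConnectedSpace_iff_subsets_isOpen_isConnected.1
      ‹_› x (W ∩ ball x (ε / 2)) (Filter.inter_mem (ho.mem_nhds hx) (ball_mem_nhds x (by linarith)))
    have hd : ∀ u ∈ V, ∀ v ∈ V, dist u v ≤ ε := by
      intro u hu v hv
      have h1 := (hVs hu).2
      have h2 := (hVs hv).2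
      rw [mem_ball] at h1 h2
      have := dist_triangle_right u v x
      linarith
    filter_upwards [mem_nhdsWithin_of_mem_nhds (hVo.mem_nhds hxV)] with y hy
    constructor
    · obtain ⟨p, hp⟩ := exists_segPath he (hd x hxV y hy)
      exact ⟨p, .seg x y V hVc.isPreconnected hVo hxV hy hd p hp, fun t => ⟨x, hx, hp t⟩⟩
    · obtain ⟨p, hp⟩ := exists_segPath he (hd y hy x hxV)
      exact ⟨p, .seg y x V hVc.isPreconnected hVo hy hxV hd p hp,
        fun t => ⟨y, (hVs hy).1, hp t⟩⟩
  · rintro x y z - - - ⟨p, hp, hp'⟩ ⟨q, hq, hq'⟩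
    refine ⟨p.trans q, .trans _ _ _ _ _ hp hq, fun t => ?_⟩
    rw [Path.trans_apply]
    split_ifs with h
    · exact hp' _
    · exact hq' _

theorem ChainPath.refine [LocallyConnectedSpace X] {e : X → E} (he : Isometry e) {ε ε' : ℝ}
    (hε : 0 < ε') (hle : ε' ≤ ε) {x y : X} {p : Path (e x) (e y)} (h : ChainPath e ε x y p) :
    ∃ p', ChainPath e ε' x y p' ∧ ∀ t, dist (p t) (p' t) ≤ 3 * ε := by
  induction h with
  | seg x y W hW ho hx hy hd p hp =>
    obtain ⟨p', hp', h⟩ := exists_chainPath he hε hW ho hx hy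
    refine ⟨p', hp', fun t => ?_⟩
    obtain ⟨w, hw, hwt⟩ := h t
    have h1 := hp t
    have h2 := hd x hx w hw
    rw [← he.dist_eq] at h2
    have h3 := dist_triangle (p t) (e x) (e w)
    have h4 := dist_triangle_right (p t) (p' t) (e w)
    linarith
  | trans x y z p q _ _ ihp ihq =>
    obtain ⟨p', hp', h⟩ := ihp
    obtain ⟨q', hq', h'⟩ := ihq
    exact ⟨p'.trans q', .trans _ _ _ _ _ hp' hq', trans_dist_le _ _ _ _ h h'⟩

theorem ChainPath.near {e : X → E} {ε : ℝ}
    {x y : X} {p : Path (e x) (e y)} (h : ChainPath e ε x y p) (t : unitInterval) :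
    ∃ w, dist (p t) (e w) ≤ ε := by
  induction h generalizing t with
  | seg x y W hW ho hx hy hd p hp => exact ⟨x, hp t⟩
  | trans x y z p q _ _ ihp ihq =>
    rw [Path.trans_apply]
    split_ifs with h
    · exact ihp _
    · exact ihq _

theorem locPath_aux [CompleteSpace E] [CompactSpace X] [LocallyConnectedSpace X] {e : X → E}
    (he : Isometry e) {ε : ℝ} (hε : 0 < ε) {W : Set X} (hW : IsPreconnected W) (ho : IsOpen W)
    {x y : X} (hx : x ∈ W) (hy : y ∈ W) (hd : ∀ u ∈ W, ∀ v ∈ W, dist u v ≤ ε) :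
    JoinedIn (closedBall x (7 * ε)) x y := by
  obtain ⟨p₀, hp₀⟩ := exists_segPath he (hd x hx y hy)
  have h₀ : ChainPath e ε x y p₀ := .seg x y W hW ho hx hy hd p₀ hp₀
  have hpos : ∀ n : ℕ, 0 < ε / 2 ^ n := fun n => by positivity
  have step : ∀ n : ℕ, ∀ p : {p : Path (e x) (e y) // ChainPath e (ε / 2 ^ n) x y p},
      ∃ p' : {p : Path (e x) (e y) // ChainPath e (ε / 2 ^ (n+1)) x y p},
        ∀ t, dist (p.1 t) (p'.1 t) ≤ 3 * (ε / 2 ^ n) := by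
    rintro n ⟨p, hp⟩
    obtain ⟨p', hp', h⟩ := hp.refine he (hpos (n+1))
      (by rw [pow_succ, ← div_div]; linarith [hpos n])
    exact ⟨⟨p', hp'⟩, h⟩
  choose S hS using step
  let P : ∀ n : ℕ, {p : Path (e x) (e y) // ChainPath e (ε / 2 ^ n) x y p} :=
    fun n => Nat.rec ⟨p₀, by simpa using h₀⟩ (fun n p => S n p) n
  have hP : ∀ n t, dist ((P n).1 t) ((P (n+1)).1 t) ≤ 3 * (ε / 2 ^ n) := fun n t => hS n (P n) t
  let c : ℕ → C(unitInterval, E) := fun n => (P n).1.toContinuousMap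
  have hc : ∀ n, dist (c n) (c (n+1)) ≤ (6 * ε) / 2 / 2 ^ n := by
    intro n
    rw [ContinuousMap.dist_le (by positivity)]
    intro t
    refine (hP n t).trans (le_of_eq ?_)
    ring
  obtain ⟨f, hf⟩ := cauchySeq_tendsto_of_complete (cauchySeq_of_le_geometric_two hc)
  have hf0 := dist_le_of_le_geometric_two_of_tendsto₀ hc hf
  have hft : ∀ t, Tendsto (fun n => (P n).1 t) atTop (𝓝 (f t)) := fun t =>
    ((continuous_eval_const t).tendsto f).comp hf
  have hcl : IsClosed (range e) := (isCompact_range he.continuous).isClosed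
  have hrange : ∀ t, f t ∈ range e := by
    intro t
    choose w hw using fun n => (P n).2.near t
    refine hcl.mem_of_tendsto (f := fun n => e (w n)) (b := atTop) ?_
      (Eventually.of_forall fun n => mem_range_self _)
    refine (hft t).congr_dist ?_
    refine squeeze_zero (fun _ => dist_nonneg) hw ?_
    have := (tendsto_pow_atTop_nhds_zero_of_lt_one (r := (1/2 : ℝ)) (by norm_num)
      (by norm_num)).const_mul ε
    simpa [div_eq_mul_inv] using this
  choose g hg using hrange
  have hgc : Continuous g := by
    rw [he.isEmbedding.continuous_iff]
    exact (show e ∘ g = f from funext hg) ▸ f.continuous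
  have e0 : f 0 = e x := tendsto_nhds_unique (hft 0) (by simp)
  have e1 : f 1 = e y := tendsto_nhds_unique (hft 1) (by simp)
  refine ⟨⟨⟨g, hgc⟩, he.injective (by rw [← e0]; exact hg 0),
    he.injective (by rw [← e1]; exact hg 1)⟩, fun t => ?_⟩
  change dist (g t) x ≤ _
  rw [← he.dist_eq, hg]
  have h1 : dist (p₀ t) (f t) ≤ 6 * ε := (ContinuousMap.dist_apply_le_dist (f := c 0) (g := f) t).trans hf0
  have h2 := hp₀ t
  have := dist_triangle_left (f t) (e x) (p₀ t)
  linarith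

theorem locPathConnected_of_locallyConnected [CompactSpace X] [LocallyConnectedSpace X] :
    LocallyPathConnectedSpace X := by
  have key : ∀ x : X, ∀ U ∈ 𝓝 x, ∃ V ∈ 𝓝 x, ∀ y ∈ V, JoinedIn U x y := by
    intro x U hU
    obtain ⟨r, hr, hrU⟩ := Metric.nhds_basis_closedBall.mem_iff.1 hU
    obtain ⟨V, hVs, hVo, hxV, hVc⟩ := locallyConnectedSpace_iff_subsets_isOpen_isConnected.1
      ‹_› x (ball x (r / 14)) (ball_mem_nhds x (by linarith))
    refine ⟨V, hVo.mem_nhds hxV, fun y hy => ?_⟩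
    have := locPath_aux (kuratowskiEmbedding.isometry X) (ε := r / 7) (by positivity)
      hVc.isPreconnected hVo hxV hy (by
        intro u hu v hv
        have h1 := hVs hu
        have h2 := hVs hv
        rw [mem_ball] at h1 h2
        have := dist_triangle_right u v x
        linarith)
    exact this.mono ((closedBall_subset_closedBall (by linarith)).trans hrU)
  refine ⟨fun x => ⟨fun U => ⟨fun hU => ?_, ?_⟩⟩⟩
  · obtain ⟨V, hV, h⟩ := key x U hU
    exact ⟨pathComponentIn U x, ⟨mem_of_superset hV h,
      isPathConnected_pathComponentIn (mem_of_mem_nhds hU)⟩, pathComponentIn_subset⟩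
  · rintro ⟨V, ⟨hV, -⟩, h⟩
    exact mem_of_superset hV h
end

section
variable {X : Type*} [MetricSpace X]

/-- Closed subsets of the interval whose gaps have endpoints with equal image. -/
def GapSet (f : unitInterval → X) (K : Set unitInterval) : Prop :=
  IsClosed K ∧ 0 ∈ K ∧ 1 ∈ K ∧ ∀ u ∈ K, ∀ v ∈ K, u < v → (∀ w ∈ K, ¬ (u < w ∧ w < v)) → f u = f v

theorem exists_last {K : Set unitInterval} (hK : IsClosed K) (h0 : 0 ∈ K) (t : unitInterval) :
    ∃ l ∈ K, l ≤ t ∧ ∀ w ∈ K, w ≤ t → w ≤ l := by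
  obtain ⟨l, hl, hl'⟩ := (hK.inter (isClosed_Iic (a := t))).isCompact.exists_isGreatest
    ⟨0, h0, unitInterval.nonneg t⟩
  exact ⟨l, hl.1, hl.2, fun w hw hwt => hl' ⟨hw, hwt⟩⟩

theorem exists_first {K : Set unitInterval} (hK : IsClosed K) (h1 : 1 ∈ K) (t : unitInterval) :
    ∃ r ∈ K, t ≤ r ∧ ∀ w ∈ K, t ≤ w → r ≤ w := by
  obtain ⟨l, hl, hl'⟩ := (hK.inter (isClosed_Ici (a := t))).isCompact.exists_isLeast
    ⟨1, h1, unitInterval.le_one t⟩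
  exact ⟨l, hl.1, hl.2, fun w hw hwt => hl' ⟨hw, hwt⟩⟩

theorem exists_minimal_gapSet {f : unitInterval → X} (hf : Continuous f) :
    ∃ K, Minimal (GapSet f) K := by
  have huniv : GapSet f univ := by
    refine ⟨isClosed_univ, trivial, trivial, fun u _ v _ huv h => ?_⟩
    obtain ⟨w, hw⟩ := exists_between huv
    exact (h w trivial hw).elim
  suffices H : ∀ c ⊆ {K | GapSet f K}, IsChain (· ⊆ ·) c → c.Nonempty →
      ∃ lb ∈ {K | GapSet f K}, ∀ s ∈ c, lb ⊆ s by
    obtain ⟨m, -, hm⟩ := zorn_superset_nonempty {K | GapSet f K} H univ huniv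
    exact ⟨m, hm⟩
  intro c hc hchain hne
  refine ⟨⋂₀ c, ⟨isClosed_sInter fun K hK => (hc hK).1, fun K hK => (hc hK).2.1,
    fun K hK => (hc hK).2.2.1, ?_⟩, fun s hs => sInter_subset_of_mem hs⟩
  intro u hu v hv huv hgap
  by_contra hne'
  obtain ⟨U, V, hU, hV, huU, hvV, hUV⟩ := t2_separation hne'
  have h1 : f ⁻¹' U ∈ 𝓝[≥] u := mem_nhdsWithin_of_mem_nhds ((hU.preimage hf).mem_nhds huU)
  have h2 : f ⁻¹' V ∈ 𝓝[≤] v := mem_nhdsWithin_of_mem_nhds ((hV.preimage hf).mem_nhds hvV)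
  obtain ⟨a₀, ha₀, ha₀'⟩ := (mem_nhdsGE_iff_exists_mem_Ioc_Ico_subset huv).1 h1
  obtain ⟨a, hua, ha⟩ := exists_between ha₀.1
  have hav : a < v := ha.trans_le ha₀.2
  obtain ⟨b₀, hb₀, hb₀'⟩ := (mem_nhdsLE_iff_exists_mem_Ico_Ioc_subset hav).1 h2
  obtain ⟨b, hb, hbv⟩ := exists_between hb₀.2
  have hab : a < b := hb₀.1.trans_lt hb
  have : Nonempty c := hne.to_subtype
  obtain ⟨⟨K, hK⟩, hKe⟩ := (isCompact_Icc (a := a) (b := b)).elim_directed_family_closed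
    (fun K : c => K.1) (fun K => (hc K.2).1) (by
      rw [← sInter_eq_iInter]
      ext w
      simp only [mem_inter_iff, mem_Icc, mem_empty_iff_false, iff_false, not_and]
      exact fun hw hwc => hgap w hwc ⟨hua.trans_le hw.1, hw.2.trans_lt hbv⟩) (by
      intro A B
      rcases hchain.total A.2 B.2 with h | h
      · exact ⟨A, le_rfl, h⟩
      · exact ⟨B, h, le_rfl⟩)
  have hKe' : ∀ w ∈ K, ¬ (a ≤ w ∧ w ≤ b) := fun w hw hw' =>
    (hKe ▸ (⟨hw', hw⟩ : w ∈ Icc a b ∩ K) : w ∈ (∅ : Set unitInterval))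
  have hG := hc hK
  obtain ⟨l, hlK, hl, hl'⟩ := exists_last hG.1 hG.2.1 a
  obtain ⟨r, hrK, hr, hr'⟩ := exists_first hG.1 hG.2.2.1 b
  have heq := hG.2.2.2 l hlK r hrK (hl.trans_lt (hab.trans_le hr)) (by
    rintro w hw ⟨h1, h2⟩
    rcases le_total w a with h | h
    · exact absurd (hl' w hw h) (not_le.2 h1)
    · rcases le_total w b with h' | h'
      · exact hKe' w hw ⟨h, h'⟩
      · exact absurd (hr' w hw h') (not_le.2 h2))
  have hlU : f l ∈ U := ha₀' ⟨hl' u (hu K hK) hua.le, hl.trans_lt ha⟩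
  have hrV : f r ∈ V := hb₀' ⟨hb.trans_le hr, hr' v (hv K hK) hbv.le⟩
  exact disjoint_left.1 hUV hlU (heq ▸ hrV)

theorem exists_monotonePath {f : unitInterval → X} (hf : Continuous f) :
    ∃ F : unitInterval → X, Continuous F ∧ F 0 = f 0 ∧ F 1 = f 1 ∧ range F ⊆ range f ∧
      ∀ s t w, s ≤ w → w ≤ t → F s = F t → F w = F s := by
  obtain ⟨K, hK, hmin⟩ := exists_minimal_gapSet hf
  obtain ⟨hcl, h0, h1, hgap⟩ := id hK
  have hconv : ∀ x ∈ K, ∀ y ∈ K, x < y → f x = f y → ∀ w ∈ K, ¬ (x < w ∧ w < y) := by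
    intro x hx y hy hxy hfxy w hw hw'
    have : GapSet f (K \ Ioo x y) := by
      refine ⟨hcl.sdiff isOpen_Ioo, ⟨h0, fun h => absurd h.1 (not_lt.2 (unitInterval.nonneg _))⟩,
        ⟨h1, fun h => absurd h.2 (not_lt.2 (unitInterval.le_one _))⟩, ?_⟩
      rintro u ⟨hu, hu'⟩ v ⟨hv, hv'⟩ huv h
      by_cases hh : ∀ w ∈ K, ¬ (u < w ∧ w < v)
      · exact hgap u hu v hv huv hh
      · push Not at hh
        obtain ⟨z, hz, huz, hzv⟩ := hh
        have hz' : x < z ∧ z < y := by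
          by_contra hcon
          exact h z ⟨hz, hcon⟩ ⟨huz, hzv⟩
        have hx' := h x ⟨hx, fun h => lt_irrefl _ h.1⟩
        have hy' := h y ⟨hy, fun h => lt_irrefl _ h.2⟩
        simp only [mem_Ioo] at hu' hv'
        have e1 : u = x := by
          apply le_antisymm
          · by_contra hc
            exact hu' ⟨not_le.1 hc, huz.trans hz'.2⟩
          · by_contra hc
            exact hx' ⟨not_le.1 hc, hz'.1.trans hzv⟩
        have e2 : v = y := by
          apply le_antisymm
          · by_contra hc
            exact hy' ⟨huz.trans hz'.2, not_le.1 hc⟩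
          · by_contra hc
            exact hv' ⟨hz'.1.trans hzv, not_le.1 hc⟩
        rw [e1, e2, hfxy]
    exact (hmin this sdiff_subset hw).2 hw'
  choose l hlK hl hl' using exists_last hcl h0
  choose r hrK hr hr' using exists_first hcl h1
  have hlr : ∀ t, f (l t) = f (r t) := by
    intro t
    rcases ((hl t).trans (hr t)).eq_or_lt with h | h
    · rw [h]
    · refine hgap _ (hlK t) _ (hrK t) h ?_
      rintro w hw ⟨h1, h2⟩
      rcases le_total w t with h | h
      · exact absurd (hl' t w hw h) (not_le.2 h1)
      · exact absurd (hr' t w hw h) (not_le.2 h2)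
  have hmem : ∀ t ∈ K, l t = t := fun t ht => le_antisymm (hl t) (hl' t t ht le_rfl)
  have hmono : Monotone l := fun s t hst => hl' t _ (hlK s) ((hl s).trans hst)
  refine ⟨fun t => f (l t), ?_, by simp only [hmem 0 h0], by simp only [hmem 1 h1],
    by rintro _ ⟨t, rfl⟩; exact mem_range_self _, ?_⟩
  · rw [continuous_iff_continuousAt]
    intro t
    by_cases ht : t ∈ K
    · have ht' := hmem t ht
      rw [Metric.continuousAt_iff]
      intro ε hε
      obtain ⟨δ, hδ, h⟩ := Metric.continuousAt_iff.1 (hf.continuousAt (x := t)) ε hε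
      refine ⟨δ, hδ, fun {s} hs => ?_⟩
      rw [ht']
      rw [Subtype.dist_eq, Real.dist_eq] at hs
      rcases le_total s t with hst | hst
      · rw [hlr s]
        apply h
        have a1 : (s : ℝ) ≤ r s := hr s
        have a2 : (r s : ℝ) ≤ t := hr' s t ht hst
        rw [Subtype.dist_eq, Real.dist_eq]
        rw [abs_lt] at hs ⊢
        constructor <;> linarith
      · apply h
        have a1 : (l s : ℝ) ≤ s := hl s
        have a2 : (t : ℝ) ≤ l s := hl' s t ht hst
        rw [Subtype.dist_eq, Real.dist_eq]
        rw [abs_lt] at hs ⊢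
        constructor <;> linarith
    · have hlt : l t < t := lt_of_le_of_ne (hl t) fun h => ht (h ▸ hlK t)
      have htr : t < r t := lt_of_le_of_ne (hr t) fun h => ht (h ▸ hrK t)
      refine continuousAt_const.congr (f := fun _ => f (l t)) ?_
      filter_upwards [Ioo_mem_nhds hlt htr] with s hs
      congr 1
      apply le_antisymm
      · refine hl' s _ (hlK t) hs.1.le
      · refine hl' t _ (hlK s) ?_
        by_contra hc
        exact absurd ((hr' t _ (hlK s) (not_le.1 hc).le).trans (hl s)) (not_le.2 hs.2)
  · intro s t w hsw hwt hst
    have m1 := hmono hsw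
    have m2 := hmono hwt
    rcases (m1.trans m2).eq_or_lt with h | h
    · have : l w = l s := le_antisymm (h ▸ m2) m1
      simp only [this]
    · have := hconv _ (hlK s) _ (hlK t) h hst _ (hlK w)
      rcases m1.eq_or_lt with h1 | h1
      · simp only [h1]
      · have : l w = l t := m2.eq_or_lt.resolve_right fun h2 => this ⟨h1, h2⟩
        simp only [this]
        exact hst.symm

/-- running maximum of the distance to `F q` on `[q,t]`. -/
noncomputable def runMax (F : unitInterval → X) (q t : unitInterval) : ℝ :=
  sSup ((fun s => dist (F q) (F (max q (min s t)))) '' univ)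

theorem runMax_bdd [CompactSpace X] (F : unitInterval → X) (q t : unitInterval) (s : unitInterval) :
    dist (F q) (F (max q (min s t))) ≤ Metric.diam (univ : Set X) :=
  Metric.dist_le_diam_of_mem isCompact_univ.isBounded trivial trivial

theorem le_runMax [CompactSpace X] (F : unitInterval → X) (q t : unitInterval) (s : unitInterval) :
    dist (F q) (F (max q (min s t))) ≤ runMax F q t := by
  refine le_csSup ⟨Metric.diam (univ : Set X), ?_⟩ ⟨s, trivial, rfl⟩
  rintro _ ⟨s, -, rfl⟩
  exact runMax_bdd F q t s

theorem runMax_le [CompactSpace X] (F : unitInterval → X) (q t : unitInterval) {B : ℝ}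
    (h : ∀ s, dist (F q) (F (max q (min s t))) ≤ B) : runMax F q t ≤ B := by
  refine csSup_le ⟨_, 0, trivial, rfl⟩ ?_
  rintro _ ⟨s, -, rfl⟩
  exact h s

theorem runMax_nonneg [CompactSpace X] (F : unitInterval → X) (q t : unitInterval) :
    0 ≤ runMax F q t := dist_nonneg.trans (le_runMax F q t 0)

theorem runMax_mono [CompactSpace X] (F : unitInterval → X) (q : unitInterval) :
    Monotone (runMax F q) := by
  intro t t' h
  refine runMax_le F q t fun s => ?_
  have := le_runMax F q t' (min s t)
  rwa [min_assoc, min_eq_left h] at this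

theorem runMax_eq_zero [CompactSpace X] (F : unitInterval → X) {q t : unitInterval} (h : t ≤ q) :
    runMax F q t = 0 := by
  refine le_antisymm (runMax_le F q t fun s => ?_) (runMax_nonneg F q t)
  rw [max_eq_left ((min_le_right _ _).trans h), dist_self]

theorem runMax_continuous {F : unitInterval → X} (hF : Continuous F) (q : unitInterval) :
    Continuous (runMax F q) := by
  unfold runMax
  refine isCompact_univ.continuous_sSup (f := fun t s => dist (F q) (F (max q (min s t)))) ?_
  simp only [Function.HasUncurry.uncurry]
  fun_prop

theorem runMax_eq [CompactSpace X] {F : unitInterval → X} {x y : unitInterval} (hxy : x ≤ y)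
    (h : ∀ w, x ≤ w → w ≤ y → F w = F x) (q : unitInterval) : runMax F q x = runMax F q y := by
  refine le_antisymm (runMax_mono F q hxy) (runMax_le F q y fun s => ?_)
  rcases le_total (min s y) x with h1 | h1
  · have := le_runMax F q x (min s y)
    rwa [min_eq_left h1] at this
  rcases le_total (min s y) q with h2 | h2
  · rw [max_eq_left h2, dist_self]
    exact runMax_nonneg F q x
  rw [max_eq_right h2, h _ h1 (min_le_right _ _)]
  rcases le_total q x with h3 | h3
  · have := le_runMax F q x 1
    rwa [min_eq_right (show _ ≤ (1 : unitInterval) from unitInterval.le_one _), max_eq_right h3] at this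
  · rw [h q h3 (h2.trans (min_le_right _ _)), dist_self]
    exact runMax_nonneg F q x

theorem exists_arc [CompactSpace X] {f : unitInterval → X} (hf : Continuous f) (hne : f 0 ≠ f 1) :
    ∃ g : unitInterval → X, Continuous g ∧ Function.Injective g ∧ g 0 = f 0 ∧ g 1 = f 1 ∧
      range g ⊆ range f := by
  obtain ⟨F, hF, F0, F1, hr, hm⟩ := exists_monotonePath hf
  let D := TopologicalSpace.denseSeq unitInterval
  have hD : DenseRange D := TopologicalSpace.denseRange_denseSeq _
  let B := Metric.diam (univ : Set X)
  let T : ℕ → unitInterval → ℝ := fun n t => (1 / 2 : ℝ) ^ n * runMax F (D n) t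
  have hTb : ∀ n t, ‖T n t‖ ≤ (1 / 2 : ℝ) ^ n * B := by
    intro n t
    rw [Real.norm_of_nonneg (mul_nonneg (by positivity) (runMax_nonneg _ _ _))]
    exact mul_le_mul_of_nonneg_left (runMax_le _ _ _ (runMax_bdd _ _ _)) (by positivity)
  have hsum : Summable fun n : ℕ => (1 / 2 : ℝ) ^ n * B := summable_geometric_two.mul_right B
  let L : unitInterval → ℝ := fun t => ∑' n, T n t
  have hLc : Continuous L :=
    continuous_tsum (fun n => continuous_const.mul (runMax_continuous hF (D n))) hsum hTb
  have hTs : ∀ t, Summable fun n => T n t := fun t =>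
    Summable.of_norm_bounded hsum (fun n => hTb n t)
  have hTm : ∀ n, Monotone (T n) := fun n s t h =>
    mul_le_mul_of_nonneg_left (runMax_mono F _ h) (by positivity)
  have hLm : Monotone L := fun s t h => (hTs s).tsum_le_tsum (fun n => hTm n h) (hTs t)
  have hLeq : ∀ x y, x ≤ y → F x = F y → L x = L y := by
    intro x y hxy h
    have : ∀ n, T n x = T n y := fun n => by
      simp only [T]
      rw [runMax_eq hxy (fun w h1 h2 => hm x y w h1 h2 h)]
    simp only [L, this]
  have hLlt : ∀ x y, x ≤ y → F x ≠ F y → L x < L y := by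
    intro x y hxy h
    have hlt : x < y := lt_of_le_of_ne hxy fun h' => h (h' ▸ rfl)
    have : ∃ q, x < q ∧ q < y ∧ F q ≠ F y ∧ ∃ n, D n = q := by
      have h1 : {w | F w ≠ F y} ∈ 𝓝[≥] x :=
        mem_nhdsWithin_of_mem_nhds ((isOpen_ne_fun hF continuous_const).mem_nhds h)
      obtain ⟨b, hb, hb'⟩ := (mem_nhdsGE_iff_exists_mem_Ioc_Ico_subset hlt).1 h1
      obtain ⟨q, hq⟩ := hD.exists_mem_open isOpen_Ioo (nonempty_Ioo.2 hb.1)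
      exact ⟨D q, hq.1, hq.2.trans_le hb.2, hb' ⟨hq.1.le, hq.2⟩, q, rfl⟩
    obtain ⟨q, hxq, hqy, hFq, n, rfl⟩ := this
    refine Summable.tsum_lt_tsum (i := n) (fun m => hTm m hxy) ?_ (hTs x) (hTs y)
    refine mul_lt_mul_of_pos_left ?_ (by positivity)
    rw [runMax_eq_zero F hxq.le]
    have := le_runMax F (D n) y 1
    rw [min_eq_right (show _ ≤ (1 : unitInterval) from unitInterval.le_one _), max_eq_right hqy.le] at this
    exact (dist_pos.2 hFq).trans_le this
  have hiff : ∀ x y, L x = L y ↔ F x = F y := by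
    intro x y
    rcases le_total x y with h | h
    · exact ⟨fun h' => by_contra fun h'' => (hLlt x y h h'').ne h', hLeq x y h⟩
    · exact ⟨fun h' => by_contra fun h'' => (hLlt y x h (Ne.symm h'')).ne h'.symm,
        fun h' => (hLeq y x h h'.symm).symm⟩
  have hL0 : L 0 = 0 := by
    have : ∀ n, T n 0 = 0 := fun n => by
      simp only [T]
      rw [runMax_eq_zero F (unitInterval.nonneg _), mul_zero]
    simp only [L, this, tsum_zero]
  have hL1 : 0 < L 1 := by
    rw [← hL0]
    exact hLlt 0 1 (unitInterval.nonneg _) (by rw [F0, F1]; exact hne)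
  have hLnn : ∀ t, 0 ≤ L t := fun t => hL0 ▸ hLm (unitInterval.nonneg t)
  let Q : unitInterval → unitInterval := fun t =>
    ⟨L t / L 1, div_nonneg (hLnn t) hL1.le, (div_le_one hL1).2 (hLm (unitInterval.le_one t))⟩
  have hQc : Continuous Q := (hLc.div_const _).subtype_mk _
  have hQ0 : Q 0 = 0 := by simp [Q, hL0]
  have hQ1 : Q 1 = 1 := by simp [Q, hL1.ne']
  have hQs : Function.Surjective Q := by
    intro t
    have := intermediate_value_univ 0 1 hQc
    exact this (by rw [hQ0, hQ1]; exact ⟨unitInterval.nonneg t, unitInterval.le_one t⟩)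
  have hQiff : ∀ x y, Q x = Q y ↔ F x = F y := by
    intro x y
    rw [← hiff]
    simp [Q, Subtype.ext_iff, div_left_inj' hL1.ne']
  have hquot : IsQuotientMap Q := hQc.isClosedMap.isQuotientMap hQc hQs
  let σ := Function.surjInv hQs
  have hσ : ∀ t, Q (σ t) = t := Function.surjInv_eq hQs
  have hgQ : ∀ t, F (σ (Q t)) = F t := fun t => (hQiff _ _).1 (hσ _)
  refine ⟨F ∘ σ, ?_, ?_, ?_, ?_, ?_⟩
  · rw [hquot.continuous_iff]
    have hh : (F ∘ σ) ∘ Q = F := funext hgQ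
    rw [hh]
    exact hF
  · intro s t h
    rw [← hσ s, ← hσ t]
    exact (hQiff _ _).2 h
  · rw [← F0, ← hgQ 0, hQ0]; rfl
  · rw [← F1, ← hgQ 1, hQ1]; rfl
  · rintro _ ⟨t, rfl⟩
    exact hr (mem_range_self _)
end

section
variable {X : Type*} [MetricSpace X]

theorem circle_of_arcs_s12 {g₁ g₂ : unitInterval → X} (c₁ : Continuous g₁) (c₂ : Continuous g₂)
    (i₁ : Function.Injective g₁) (i₂ : Function.Injective g₂) (h0 : g₁ 0 = g₂ 0)
    (h1 : g₁ 1 = g₂ 1) (hd : ∀ s t, g₁ s = g₂ t → t = 0 ∨ t = 1) :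
    ∃ S : Set X, Nonempty (S ≃ₜ (Metric.sphere (0 : ℂ) 1 : Set ℂ)) := by
  have hsq : ∀ w : (Metric.sphere (0 : ℂ) 1 : Set ℂ), w.1.re ^ 2 + w.1.im ^ 2 = 1 := by
    intro w
    have h := w.2
    rw [mem_sphere_zero_iff_norm] at h
    have h2 := Complex.sq_norm w.1
    rw [h, Complex.normSq_apply] at h2
    nlinarith
  let φ : (Metric.sphere (0 : ℂ) 1 : Set ℂ) → unitInterval := fun w =>
    ⟨(1 - w.1.re) / 2, by nlinarith [hsq w, sq_nonneg w.1.im],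
      by nlinarith [hsq w, sq_nonneg w.1.im]⟩
  have hφ : Continuous φ := by
    refine Continuous.subtype_mk ?_ _
    have := Complex.continuous_re
    fun_prop
  have hφe : ∀ w, φ w = 0 ∨ φ w = 1 → w.1.im = 0 := by
    intro w h
    have hw := hsq w
    have : w.1.re = 1 ∨ w.1.re = -1 := by
      rcases h with h | h
      · left
        have := congrArg Subtype.val h
        simp only [φ, Set.Icc.coe_zero] at this
        linarith
      · right
        have := congrArg Subtype.val h
        simp only [φ, Set.Icc.coe_one] at this
        linarith
    have : w.1.im ^ 2 = 0 := by
      rcases this with h | h <;> rw [h] at hw <;> linarith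
    exact pow_eq_zero_iff two_ne_zero |>.1 this
  have hφi : ∀ w w', φ w = φ w' → w.1.re = w'.1.re := by
    intro w w' h
    have := congrArg Subtype.val h
    simp only [φ] at this
    linarith
  have hend : ∀ s t, g₁ s = g₂ t → s = t ∧ (t = 0 ∨ t = 1) := by
    intro s t h
    refine ⟨?_, hd s t h⟩
    rcases hd s t h with rfl | rfl
    · exact i₁ (h.trans h0.symm)
    · exact i₁ (h.trans h1.symm)
  let H : (Metric.sphere (0 : ℂ) 1 : Set ℂ) → X := fun w =>
    if 0 ≤ w.1.im then g₁ (φ w) else g₂ (φ w)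
  have hH : Continuous H := by
    refine Continuous.if_le (c₁.comp hφ) (c₂.comp hφ) continuous_const
      (Complex.continuous_im.comp continuous_subtype_val) ?_
    intro w hw
    have hw' := hsq w
    have hw0 : w.1.im = 0 := hw.symm
    rw [hw0] at hw'
    have : (w.1.re - 1) * (w.1.re + 1) = 0 := by linarith
    rcases mul_eq_zero.1 this with h | h
    · have : φ w = 0 := by
        apply Subtype.ext
        simp only [φ, Set.Icc.coe_zero]; linarith
      simp only [Function.comp, this, h0]
    · have : φ w = 1 := by
        apply Subtype.ext
        simp only [φ, Set.Icc.coe_one]; linarith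
      simp only [Function.comp, this, h1]
  have hHi : Function.Injective H := by
    intro w w' h
    have hw := hsq w
    have hw' := hsq w'
    have fin : w.1.re = w'.1.re → w.1.im = w'.1.im → w = w' := fun h1 h2 =>
      Subtype.ext (Complex.ext h1 h2)
    simp only [H] at h
    split_ifs at h with a b b
    · have hre := hφi _ _ (i₁ h)
      refine fin hre ?_
      rw [hre] at hw
      have : w.1.im ^ 2 = w'.1.im ^ 2 := by linarith
      exact (sq_eq_sq₀ a b).1 this
    · obtain ⟨e, he⟩ := hend _ _ h
      refine fin (hφi _ _ e) ?_
      rw [hφe _ he, hφe _ (e ▸ he)]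
    · obtain ⟨e, he⟩ := hend _ _ h.symm
      refine fin (hφi _ _ e.symm) ?_
      rw [hφe _ he, hφe _ (e ▸ he)]
    · have hre := hφi _ _ (i₂ h)
      refine fin hre ?_
      rw [hre] at hw
      have : (-w.1.im) ^ 2 = (-w'.1.im) ^ 2 := by linarith
      have := (sq_eq_sq₀ (by linarith) (by linarith)).1 this
      linarith
  have : CompactSpace (Metric.sphere (0 : ℂ) 1 : Set ℂ) :=
    isCompact_iff_compactSpace.1 (isCompact_sphere 0 1)
  have hemb : IsEmbedding H := (hH.isClosedEmbedding hHi).isEmbedding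
  exact ⟨range H, ⟨hemb.toHomeomorph.symm⟩⟩

theorem exists_affine {u v : unitInterval} (h : u < v) : ∃ σ : unitInterval → unitInterval,
    Continuous σ ∧ Function.Injective σ ∧ σ 0 = u ∧ σ 1 = v ∧ ∀ t, u ≤ σ t ∧ σ t ≤ v := by
  have huv : (0 : ℝ) < v - u := sub_pos.2 h
  have hb : ∀ t : unitInterval, (u : ℝ) ≤ u + t * (v - u) ∧ (u : ℝ) + t * (v - u) ≤ v := by
    intro t
    have h0 := t.2.1
    have h1 := t.2.2
    constructor <;> nlinarith
  refine ⟨fun t => ⟨u + t * (v - u), u.2.1.trans (hb t).1, (hb t).2.trans v.2.2⟩, ?_, ?_, ?_, ?_, hb⟩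
  · refine Continuous.subtype_mk ?_ _
    fun_prop
  · intro s t hst
    have := congrArg Subtype.val hst
    simp only at this
    exact Subtype.ext (mul_right_cancel₀ huv.ne' (by linarith))
  · apply Subtype.ext; simp
  · apply Subtype.ext; simp

theorem arc_subset (hX : IsDendrite X) {γ : unitInterval → X} (hγ : Continuous γ)
    (hi : Function.Injective γ) {D : Set X} (hD : IsConnected D) (h0 : γ 0 ∈ D) (h1 : γ 1 ∈ D) :
    range γ ⊆ D := by
  obtain ⟨hc, -, hl, hcirc⟩ := hX
  rintro _ ⟨t₀, rfl⟩
  by_contra hp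
  have : LocallyPathConnectedSpace X := locPathConnected_of_locallyConnected
  have hsub : D ⊆ {γ t₀}ᶜ := fun x hx h => hp (h ▸ hx)
  have hopen : IsOpen ({γ t₀}ᶜ : Set X) := isOpen_compl_singleton
  let C := connectedComponentIn ({γ t₀}ᶜ : Set X) (γ 0)
  have hC : IsConnected C := isConnected_connectedComponentIn_iff.2 (hsub h0)
  have hDC : D ⊆ C := hD.isPreconnected.subset_connectedComponentIn h0 hsub
  have hCo : IsOpen C := hopen.connectedComponentIn
  have hj := (hCo.isConnected_iff_isPathConnected.1 hC).joinedIn _ (hDC h0) _ (hDC h1)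
  let f := hj.somePath
  have hfp : ∀ t, f t ≠ γ t₀ := fun t => connectedComponentIn_subset _ _ (hj.somePath_mem t)
  obtain ⟨g, gc, gi, g0, g1, gr⟩ := exists_arc f.continuous
    (by rw [f.source, f.target]; exact fun h => zero_ne_one (hi h))
  rw [f.source] at g0
  rw [f.target] at g1
  have hgp : ∀ t, g t ≠ γ t₀ := by
    intro t
    obtain ⟨s, hs⟩ := gr (mem_range_self t)
    rw [← hs]; exact hfp s
  have hP : IsClosed (g ⁻¹' (γ '' Iic t₀)) :=
    ((isClosed_Iic.isCompact.image hγ).isClosed).preimage gc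
  have hQ : IsClosed (g ⁻¹' (γ '' Ici t₀)) :=
    ((isClosed_Ici.isCompact.image hγ).isClosed).preimage gc
  obtain ⟨s₁, ⟨u, hu, hus⟩, -, hs₁⟩ := exists_last hP ⟨0, unitInterval.nonneg _, g0.symm⟩ 1
  obtain ⟨s₂, ⟨v, hv, hvs⟩, h12, hs₂⟩ := exists_first hQ ⟨1, unitInterval.le_one _, g1.symm⟩ s₁
  have hu' : u < t₀ := lt_of_le_of_ne hu fun h => hgp s₁ (by rw [← hus, h])
  have hv' : t₀ < v := lt_of_le_of_ne hv fun h => hgp s₂ (by rw [← hvs, h])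
  have huv : u < v := hu'.trans hv'
  have hlt : s₁ < s₂ := lt_of_le_of_ne h12 fun h => huv.ne (hi (by rw [hus, hvs, h]))
  obtain ⟨σ, σc, σi, σ0, σ1, -⟩ := exists_affine huv
  obtain ⟨τ, τc, τi, τ0, τ1, τb⟩ := exists_affine hlt
  obtain ⟨S, hS⟩ := circle_of_arcs_s12 (hγ.comp σc) (gc.comp τc) (hi.comp σi) (gi.comp τi)
    (by simp [σ0, τ0, hus]) (by simp [σ1, τ1, hvs]) (by
      intro s t h
      simp only [Function.comp] at h
      rcases le_total (σ s) t₀ with h' | h'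
      · left
        apply τi
        rw [τ0]
        exact le_antisymm (hs₁ _ ⟨_, h', h⟩ (unitInterval.le_one _)) (τb t).1
      · right
        apply τi
        rw [τ1]
        exact le_antisymm (τb t).2 (hs₂ _ ⟨_, h', h⟩ (τb t).1))
  exact hcirc S hS

theorem arcOrPt_props {A : Set X} {x y : X} (h : IsArcOrPt A x y) :
    x ∈ A ∧ y ∈ A ∧ IsConnected A ∧ IsClosed A := by
  rcases h with ⟨rfl, rfl⟩ | ⟨γ, hγ, -, rfl, rfl, rfl⟩
  · exact ⟨rfl, rfl, isConnected_singleton, isClosed_singleton⟩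
  · exact ⟨mem_range_self _, mem_range_self _, isConnected_range hγ, (isCompact_range hγ).isClosed⟩

theorem arcOrPt_subset (hX : IsDendrite X) {A : Set X} {x y : X} (h : IsArcOrPt A x y)
    {D : Set X} (hD : IsConnected D) (hx : x ∈ D) (hy : y ∈ D) : A ⊆ D := by
  rcases h with ⟨rfl, rfl⟩ | ⟨γ, hγ, hi, rfl, rfl, rfl⟩
  · exact singleton_subset_iff.2 hx
  · exact arc_subset hX hγ hi hD hx hy
end

theorem stmt12 {X : Type*} [MetricSpace X] (hX : IsDendrite X)
    (F : Set X) (hFne : F.Nonempty) (hFcl : IsClosed F) (a : X) (ha : a ∈ F)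
    (A : X → Set X) (hA : ∀ z ∈ F, IsArcOrPt (A z) a z) :
    dendriteHull F = ⋃ z ∈ F, A z := by
  have hsubD : ∀ D : Set X, F ⊆ D → IsConnected D → (⋃ z ∈ F, A z) ⊆ D := fun D hFD hD =>
    iUnion₂_subset fun z hz => arcOrPt_subset hX (hA z hz) hD (hFD ha) (hFD hz)
  have hFU : F ⊆ ⋃ z ∈ F, A z := fun z hz =>
    mem_iUnion₂.2 ⟨z, hz, (arcOrPt_props (hA z hz)).2.1⟩
  apply Subset.antisymm
  · refine sInter_subset_of_mem ⟨hFU, ?_, ?_⟩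
    · -- closedness
      have hc : CompactSpace X := hX.1
      have hl : LocallyConnectedSpace X := hX.2.2.1
      rw [← closure_subset_iff_isClosed]
      intro p hp
      by_contra hpU
      have hpA : ∀ z ∈ F, p ∉ A z := fun z hz h => hpU (mem_iUnion₂.2 ⟨z, hz, h⟩)
      have hloc : ∀ z ∈ F, ∃ V : Set X, IsOpen V ∧ z ∈ V ∧ IsConnected V ∧ p ∉ closure V := by
        intro z hz
        have hzp : z ≠ p := fun h => hpU (h ▸ hFU hz)
        obtain ⟨O, hO, hOc, hOs⟩ := exists_mem_nhds_isClosed_subset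
          (isOpen_compl_singleton.mem_nhds (show z ∈ ({p}ᶜ : Set X) from hzp))
        obtain ⟨V, hVs, hVo, hxV, hVc⟩ :=
          locallyConnectedSpace_iff_subsets_isOpen_isConnected.1 hl z O hO
        exact ⟨V, hVo, hxV, hVc, fun h => hOs (closure_minimal hVs hOc h) rfl⟩
      choose! V hVo hzV hVc hpV using hloc
      obtain ⟨T, hTF, hT⟩ := hFcl.isCompact.elim_nhds_subcover V
        (fun z hz => (hVo z hz).mem_nhds (hzV z hz))
      let N : Set X := ⋃ z ∈ T, (closure (V z) ∪ A z)
      have hNcl : IsClosed N := T.finite_toSet.isClosed_biUnion fun z hz =>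
        isClosed_closure.union (arcOrPt_props (hA z (hTF z hz))).2.2.2
      have hpN : p ∉ N := by
        intro h
        obtain ⟨z, hz, h | h⟩ := mem_iUnion₂.1 h
        · exact hpV z (hTF z hz) h
        · exact hpA z (hTF z hz) h
      have hFN : F ⊆ N := fun x hx => by
        obtain ⟨z, hz, h⟩ := mem_iUnion₂.1 (hT hx)
        exact mem_iUnion₂.2 ⟨z, hz, Or.inl (subset_closure h)⟩
      have hNc : IsConnected N := by
        refine ⟨⟨a, hFN ha⟩, ?_⟩
        refine isPreconnected_of_forall a fun y hy => ?_
        obtain ⟨z, hz, h⟩ := mem_iUnion₂.1 hy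
        have hp := arcOrPt_props (hA z (hTF z hz))
        refine ⟨closure (V z) ∪ A z, subset_biUnion_of_mem (u := fun z => closure (V z) ∪ A z) hz,
          Or.inr hp.1, h, ?_⟩
        exact IsPreconnected.union z (subset_closure (hzV z (hTF z hz))) hp.2.1
          (hVc z (hTF z hz)).isPreconnected.closure hp.2.2.1.isPreconnected
      exact hpN (closure_minimal (hsubD N hFN hNc) hNcl hp)
    · refine ⟨⟨a, hFU ha⟩, isPreconnected_of_forall a fun y hy => ?_⟩
      obtain ⟨z, hz, h⟩ := mem_iUnion₂.1 hy
      have hp := arcOrPt_props (hA z hz)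
      exact ⟨A z, subset_biUnion_of_mem (u := A) hz, hp.1, h, hp.2.2.1.isPreconnected⟩
  · exact subset_sInter fun D hD => hsubD D hD.1 hD.2.2
end
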